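/- Let K be any field and let d = (d_0 < d_1 < ... < d_n) be a strictly increasing sequence of n+1 integers. There exists a graded K[x_1,...,x_n]-module of finite length with β_0 = ∏_{i=1}^{n} binom(d_i − d_0 − 1, d_i − d_{i−1} − 1) generators whose minimal graded free resolution is pure with degree sequence d. -/

import Mathlib

open MvPolynomial Finset Module

noncomputable section

/-- The standard graded polynomial ring `S = K[x_1, …, x_n]`. -/
abbrev PolyS (K : Type) [Field K] (n : ℕ) : Type := MvPolynomial (Fin n) K

/-- The `K`-subspace of homogeneous polynomials of integer degree `z`
(it is `0` if `z < 0`). -/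
def homogZ (K : Type) [Field K] (n : ℕ) (z : ℤ) : Submodule K (PolyS K n) :=
  ⨆ (_ : 0 ≤ z), MvPolynomial.homogeneousSubmodule (Fin n) K z.toNat

/-- The degree-`ℓ` piece of the graded free module `⊕ₚ S(-dg p)`. -/
def freePiece {K : Type} [Field K] {n r : ℕ} (dg : Fin r → ℤ) (ℓ : ℤ) :
    Submodule K (Fin r → PolyS K n) :=
  Submodule.pi Set.univ fun p => homogZ K n (ℓ - dg p)

/-- A (homologically indexed) finite complex of graded free `S`-modules
`F₀ ← F₁ ← ⋯ ← F_len ← 0`, where `Fᵢ = ⊕ₚ S(-deg i p)` and the (degree `0`)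
map `Fᵢ₊₁ → Fᵢ` is given by the matrix `dd i`, whose entries are homogeneous
of the appropriate degrees. -/
structure FreeComplex (K : Type) [Field K] (n : ℕ) where
  len : ℕ
  rk : ℕ → ℕ
  deg : (i : ℕ) → Fin (rk i) → ℤ
  dd : (i : ℕ) → Matrix (Fin (rk i)) (Fin (rk (i+1))) (PolyS K n)
  rk_eq_zero : ∀ i, len < i → rk i = 0
  isHomog : ∀ i p q, dd i p q ∈ homogZ K n (deg (i+1) q - deg i p)
  isComplex : ∀ i, dd i * dd (i+1) = 0

variable {K : Type} [Field K] {n : ℕ}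

/-- `F` is exact in positive homological degrees; that is, it is a graded free
resolution of the finitely generated graded module `M = coker (F₁ → F₀)`. -/
def IsResolution (F : FreeComplex K n) : Prop :=
  ∀ i, LinearMap.ker ((F.dd i).mulVecLin) = LinearMap.range ((F.dd (i+1)).mulVecLin)

/-- The complex is minimal: entries of the differentials lie in the maximal ideal,
i.e. all (constant) entries between generators of equal degrees vanish. -/
def IsMinimal (F : FreeComplex K n) : Prop :=
  ∀ i p q, F.deg (i+1) q = F.deg i p → F.dd i p q = 0

/-- Betti number `β_{i,j}`: the number of generators of `Fᵢ` of degree `j`. -/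
def bettiNum (F : FreeComplex K n) (i : ℕ) (j : ℤ) : ℕ :=
  (Finset.univ.filter fun p => F.deg i p = j).card

/-- The dimension of the degree-`ℓ` piece of the module `M = coker (F₁ → F₀)`
resolved by `F`. -/
def MPieceDim (F : FreeComplex K n) (ℓ : ℤ) : ℕ :=
  finrank K ((freePiece (F.deg 0) ℓ) ⧸
    (Submodule.comap (freePiece (F.deg 0) ℓ).subtype
      ((LinearMap.range ((F.dd 0).mulVecLin)).restrictScalars K)))

/-- The Hilbert polynomial of the twisted free module `S(-a)` in `n` variables:
`binom (t - a + n - 1, n - 1)`. -/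
def genHilb (n : ℕ) (a : ℤ) : Polynomial ℚ :=
  if n = 0 then 0 else
    Polynomial.C (((n - 1).factorial : ℚ))⁻¹ *
      ∏ k ∈ Finset.range (n - 1),
        (Polynomial.X - Polynomial.C (a : ℚ) + Polynomial.C ((k : ℚ) + 1))

/-- The Hilbert polynomial of `M = coker (F₁ → F₀)`, computed from the free
resolution `F` by additivity. -/
def hilbPoly (F : FreeComplex K n) : Polynomial ℚ :=
  ∑ i ∈ Finset.range (F.len + 1),
    Polynomial.C ((-1 : ℚ) ^ i) * ∑ p : Fin (F.rk i), genHilb n (F.deg i p)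

/-- The Krull dimension of a module read off from its Hilbert polynomial:
`0` for the zero polynomial (finite length), `deg + 1` otherwise. -/
def polyDim (P : Polynomial ℚ) : ℕ := if P = 0 then 0 else P.natDegree + 1

/-- `M = coker (F₁ → F₀)` is a Cohen-Macaulay module of codimension `c`:
`F` is a minimal free resolution of length exactly `c` (so `pd M = c`, and by
Auslander–Buchsbaum `depth M = n - c`) and `dim M = n - c`. -/
def IsCMcodim (F : FreeComplex K n) (c : ℕ) : Prop :=
  IsResolution F ∧ IsMinimal F ∧ (∀ i, c < i → F.rk i = 0) ∧ F.rk c ≠ 0 ∧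
    polyDim (hilbPoly F) = n - c

/-- The multiplicity `e(M)` of a module of codimension `c`, computed from the
Betti numbers of a free resolution:
`e(M) = ((-1)^c / c!) ⬝ Σ_{i,j} (-1)^i β_{i,j} j^c`. -/
def multQ (F : FreeComplex K n) (c : ℕ) : ℚ :=
  ((-1 : ℚ) ^ c / c.factorial) *
    ∑ i ∈ Finset.range (F.len + 1),
      (-1 : ℚ) ^ i * ∑ p : Fin (F.rk i), ((F.deg i p : ℚ)) ^ c



namespace PR

/-! ### A homological perturbation lemma in a ring -/

section Perturb
variable {E : Type*} [Ring E]

/-- The data of a perturbation problem inside the corner `P E P` of a ring. -/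
structure Pert (P d d0 h p Y Y' : E) : Prop where
  dd : d * d = 0
  d0d0 : d0 * d0 = 0
  hh : h * h = 0
  Pd : P * d = d
  dP : d * P = d
  Pd0 : P * d0 = d0
  d0P : d0 * P = d0
  pp : p * p = p
  hp : h * p = 0
  ph : p * h = 0
  d0p : d0 * p = 0
  pd0 : p * d0 = 0
  hom : p = P - d0 * h - h * d0
  Y1 : (1 + h * (d - d0)) * Y = 1
  Y2 : Y * (1 + h * (d - d0)) = 1
  Y'1 : (1 + (d - d0) * h) * Y' = 1
  Y'2 : Y' * (1 + (d - d0) * h) = 1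

variable {P d d0 h p Y Y' : E}

theorem Pert.incl (H : Pert P d d0 h p Y Y') :
    d * (Y * p) = (Y * p) * (p * (d - d0) * Y * p) := by
  obtain ⟨dd, d0d0, hh, Pd, dP, Pd0, d0P, pp, hp, ph, d0p, pd0, hom, Y1, Y2, Y'1, Y'2⟩ := H
  obtain ⟨δ, rfl⟩ : ∃ δ, d = d0 + δ := ⟨d - d0, by abel⟩
  simp only [add_sub_cancel_left] at *
  have e1 : d0 * δ = - (δ * d0) - δ * δ := by
    have := dd; simp only [add_mul, mul_add, d0d0] at this
    rw [← sub_eq_zero, ← this]; abel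
  have e2 : h * (δ * Y) = 1 - Y := by
    rw [add_mul, one_mul, mul_assoc] at Y1; rw [← Y1]; abel
  have e3 : P * δ = δ := by
    rw [mul_add, Pd0] at Pd; exact add_left_cancel Pd
  symm
  calc (Y * p) * (p * δ * Y * p) = Y * ((p * p) * δ * Y * p) := by noncomm_ring
    _ = Y * ((P - d0 * h - h * d0) * δ * Y * p) := by rw [pp, ← hom]
    _ = Y * ((P * δ) * Y * p - d0 * (h * (δ * Y)) * p - h * (d0 * δ) * Y * p) := by noncomm_ring
    _ = Y * (δ * Y * p - (d0 * p) + d0 * Y * p + h * (δ * d0) * Y * p + h * (δ * δ) * Y * p) := by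
        rw [e3, e2, e1]; noncomm_ring
    _ = (Y * (1 + h * δ)) * ((d0 + δ) * (Y * p)) := by rw [d0p]; noncomm_ring
    _ = _ := by rw [Y2, one_mul]

theorem Pert.YY' (H : Pert P d d0 h p Y Y') : (d - d0) * Y = Y' * (d - d0) := by
  have h1 : (1 + (d - d0) * h) * (d - d0) = (d - d0) * (1 + h * (d - d0)) := by noncomm_ring
  calc (d - d0) * Y = (Y' * (1 + (d - d0) * h)) * ((d - d0) * Y) := by rw [H.Y'2, one_mul]
    _ = Y' * ((1 + (d - d0) * h) * (d - d0)) * Y := by noncomm_ring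
    _ = Y' * (d - d0) * ((1 + h * (d - d0)) * Y) := by rw [h1]; noncomm_ring
    _ = _ := by rw [H.Y1, mul_one]

theorem Pert.proj (H : Pert P d d0 h p Y Y') :
    (p * Y') * d = (p * (d - d0) * Y * p) * (p * Y') := by
  have hy := H.YY'
  obtain ⟨dd, d0d0, hh, Pd, dP, Pd0, d0P, pp, hp, ph, d0p, pd0, hom, Y1, Y2, Y'1, Y'2⟩ := H
  obtain ⟨δ, rfl⟩ : ∃ δ, d = d0 + δ := ⟨d - d0, by abel⟩
  simp only [add_sub_cancel_left] at *
  have e1 : δ * d0 = - (d0 * δ) - δ * δ := by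
    have := dd; simp only [add_mul, mul_add, d0d0] at this
    rw [← sub_eq_zero, ← this]; abel
  have e2 : Y' * δ * h = 1 - Y' := by
    rw [mul_add, mul_one, ← mul_assoc] at Y'2; rw [← Y'2]; abel
  have e3 : δ * P = δ := by
    rw [add_mul, d0P] at dP; exact add_left_cancel dP
  symm
  calc (p * δ * Y * p) * (p * Y') = p * (δ * Y) * (p * p) * Y' := by noncomm_ring
    _ = p * (Y' * δ) * (P - d0 * h - h * d0) * Y' := by rw [pp, ← hom, hy]
    _ = p * Y' * (δ * P) * Y' - p * Y' * (δ * d0) * h * Y' - p * (Y' * δ * h) * d0 * Y' := by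
        noncomm_ring
    _ = p * Y' * δ * Y' + p * Y' * (d0 * δ) * h * Y' + p * Y' * δ * δ * h * Y'
          - (p * d0) * Y' + p * Y' * d0 * Y' := by
        rw [e3, e2, e1]; noncomm_ring
    _ = p * Y' * (d0 + δ) * ((1 + δ * h) * Y') := by rw [pd0]; noncomm_ring
    _ = _ := by rw [Y'1, mul_one]

theorem Pert.retract (H : Pert P d d0 h p Y Y') : (p * Y') * (Y * p) = p := by
  have a1 : Y = 1 - h * (d - d0) * Y := by
    have := H.Y1; rw [add_mul, one_mul] at this; rw [← this]; abel
  have a2 : Y' = 1 - Y' * (d - d0) * h := by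
    have := H.Y'2; rw [mul_add, mul_one] at this; rw [← this]; noncomm_ring
  calc (p * Y') * (Y * p) = p * ((1 - Y' * (d - d0) * h) * (1 - h * (d - d0) * Y)) * p := by
        rw [← a1, ← a2]; noncomm_ring
    _ = p * p - p * Y' * (d - d0) * (h * p) - (p * h) * (d - d0) * Y * p
        + p * Y' * (d - d0) * (h * h) * (d - d0) * Y * p := by noncomm_ring
    _ = p := by rw [H.hp, H.ph, H.hh, H.pp]; noncomm_ring

theorem Pert.sq (H : Pert P d d0 h p Y Y') :
    (p * (d - d0) * Y * p) * (p * (d - d0) * Y * p) = 0 := by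
  have h1 := H.incl
  have h2 : p * (p * (d - d0) * Y * p) = p * (d - d0) * Y * p := by
    simp only [← mul_assoc, H.pp]
  generalize p * (d - d0) * Y * p = F at h1 h2
  calc F * F = ((p * Y') * (Y * p)) * F * F := by rw [H.retract, h2]
    _ = (p * Y') * ((Y * p) * F * F) := by noncomm_ring
    _ = (p * Y') * (d * ((Y * p) * F)) := by
        conv_lhs => rw [← h1]
        rw [mul_assoc d]
    _ = (p * Y') * ((d * d) * (Y * p)) := by rw [← h1]; noncomm_ring
    _ = 0 := by rw [H.dd]; simp

end Perturb

/-! ### The acyclicity lemma -/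

open RingTheory.Sequence in
theorem acyc {S : Type} [CommRing S] : ∀ (xs : List S) (M : ℕ → Type)
    [∀ i, AddCommGroup (M i)] [∀ i, Module S (M i)] (d : ∀ i, M (i+1) →ₗ[S] M i)
    (_ : ∀ i z, d i (d (i+1) z) = 0) (L : ℕ) (_ : ∀ i, L < i → Subsingleton (M i))
    (_ : ∀ i, IsWeaklyRegular (M i) xs)
    (_ : ∀ x ∈ xs, ∀ z : M 0, ∃ e : ℕ, ∃ w, x ^ e • z = d 0 w)
    (_ : ∀ x ∈ xs, ∀ i, ∀ z, d i z = 0 → ∃ e : ℕ, ∃ w, x ^ e • z = d (i+1) w),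
    ∀ i, L < i + 1 + xs.length → ∀ z, d i z = 0 → ∃ w, z = d (i+1) w := by
  intro xs
  induction xs with
  | nil =>
    intro M _ _ d hd L hM _ _ _ i hi z _
    have := hM (i+1) (by simpa using hi)
    exact ⟨0, Subsingleton.elim _ _⟩
  | cons x xs ih =>
    intro M _ _ d hd L hM hreg ht0 ht i hi z hz
    simp only [isWeaklyRegular_cons_iff] at hreg
    have hinj : ∀ i (a b : M i), x • a = x • b → a = b := fun i a b h => (hreg i).1 h
    have mk0 : ∀ i (a : M i), (Submodule.Quotient.mk a : QuotSMulTop x (M i)) = 0 ↔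
        ∃ b, a = x • b := by
      intro i a
      rw [Submodule.Quotient.mk_eq_zero, Submodule.mem_smul_pointwise_iff_exists]
      simp [eq_comm]
    have key := ih (fun i => QuotSMulTop x (M i)) (fun i => QuotSMulTop.map x (d i))
      (by
        intro i z
        obtain ⟨z, rfl⟩ := Submodule.Quotient.mk_surjective _ z
        show (Submodule.Quotient.mk (d i (d (i+1) z)) : QuotSMulTop x (M i)) = 0
        rw [hd]; rfl)
      L (by
        intro i hi
        have := hM i hi
        exact (Submodule.Quotient.mk_surjective _).subsingleton)
      (fun i => (hreg i).2)
      (by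
        intro t htm z
        obtain ⟨z, rfl⟩ := Submodule.Quotient.mk_surjective _ z
        obtain ⟨e, w, hw⟩ := ht0 t (List.mem_cons_of_mem _ htm) z
        refine ⟨e, Submodule.Quotient.mk w, ?_⟩
        show (Submodule.Quotient.mk (t ^ e • z) : QuotSMulTop x (M 0)) =
          Submodule.Quotient.mk (d 0 w)
        rw [hw])
      (by
        intro t htm i z hz
        obtain ⟨z, rfl⟩ := Submodule.Quotient.mk_surjective _ z
        change (Submodule.Quotient.mk (d i z) : QuotSMulTop x (M i)) = 0 at hz
        rw [mk0] at hz
        obtain ⟨w, hw⟩ := hz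
        have : ∃ e : ℕ, ∃ u, t ^ e • w = d i u := by
          cases i with
          | zero => exact ht0 t (List.mem_cons_of_mem _ htm) w
          | succ i =>
            refine ht t (List.mem_cons_of_mem _ htm) i w ?_
            apply hinj
            rw [← map_smul, ← hw, hd, smul_zero]
        obtain ⟨e, u, hu⟩ := this
        obtain ⟨f, v, hv⟩ := ht t (List.mem_cons_of_mem _ htm) i (t ^ e • z - x • u) (by
          rw [map_sub, map_smul, map_smul, hw, smul_comm, hu, sub_self])
        refine ⟨f + e, Submodule.Quotient.mk v, ?_⟩
        show (Submodule.Quotient.mk (t ^ (f + e) • z) : QuotSMulTop x (M (i+1))) =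
          Submodule.Quotient.mk (d (i+1) v)
        rw [← sub_eq_zero, ← Submodule.Quotient.mk_sub, mk0]
        refine ⟨t ^ f • u, ?_⟩
        rw [← hv, smul_sub, smul_smul, ← pow_add, smul_comm x]
        abel)
    have step : ∀ y : M (i+1), d i y = 0 → (∃ w, x • y = d (i+1) w) → ∃ w, y = d (i+1) w := by
      rintro y hy ⟨w, hw⟩
      obtain ⟨u, hu⟩ := key (i+1) (by simp only [List.length_cons] at hi; omega)
        (Submodule.Quotient.mk w) (by
          show (Submodule.Quotient.mk (d (i+1) w) : QuotSMulTop x (M (i+1))) = 0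
          rw [mk0]; exact ⟨y, hw.symm⟩)
      obtain ⟨u, rfl⟩ := Submodule.Quotient.mk_surjective _ u
      change (Submodule.Quotient.mk w : QuotSMulTop x (M (i+2))) =
          Submodule.Quotient.mk (d (i+2) u) at hu
      rw [← sub_eq_zero, ← Submodule.Quotient.mk_sub, mk0] at hu
      obtain ⟨v, hv⟩ := hu
      refine ⟨v, hinj _ _ _ ?_⟩
      rw [hw, ← map_smul, ← hv, map_sub, hd, sub_zero]
    obtain ⟨e, he⟩ := ht x List.mem_cons_self i z hz
    induction e with
    | zero => simpa using he
    | succ e ihe =>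
      apply ihe
      apply step
      · rw [map_smul, hz, smul_zero]
      · rw [smul_smul, ← pow_succ']; exact he

end PR

namespace PR
set_option linter.unusedSectionVars false
set_option linter.style.haveILetI false

/-! ### Clifford relations on functions of finite sets -/

section Clifford
variable {ι : Type} [DecidableEq ι] (o : ι → ℕ) (S : Type) [CommRing S]
  {Z : Type} [AddCommGroup Z] [Module S Z]

def sg (w : ι) (W : Finset ι) : S := (-1) ^ (W.filter (fun u => o u < o w)).card

variable {S}

theorem sg_insert (w : ι) {w' : ι} {W : Finset ι} (h : w' ∉ W) :
    sg o S w (insert w' W) = (if o w' < o w then -1 else 1) * sg o S w W := by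
  unfold sg
  rw [filter_insert]
  split_ifs with h1
  · rw [card_insert_of_notMem (by simp [h]), pow_succ, mul_comm]
  · rw [one_mul]

theorem sg_insert_self (w : ι) (W : Finset ι) : sg o S w (insert w W) = sg o S w W := by
  by_cases h : w ∈ W
  · rw [insert_eq_of_mem h]
  · rw [sg_insert o w h]; simp

theorem sg_erase_self (w : ι) (W : Finset ι) : sg o S w (W.erase w) = sg o S w W := by
  by_cases h : w ∈ W
  · conv_rhs => rw [← insert_erase h]
    rw [sg_insert_self]
  · rw [erase_eq_of_notMem h]

theorem sg_mul_self (w : ι) (W : Finset ι) : sg o S w W * sg o S w W = 1 := by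
  unfold sg; rw [← pow_add, ← two_mul, pow_mul]; simp

theorem sg_mul_mul_self (w : ι) (W : Finset ι) (a : S) :
    sg o S w W * (sg o S w W * a) = a := by
  rw [← mul_assoc, sg_mul_self, one_mul]

/-- contraction -/
def con (w : ι) : Module.End S (Finset ι → Z) where
  toFun z W := if w ∈ W then 0 else sg o S w W • z (insert w W)
  map_add' a b := by ext W; simp only [Pi.add_apply]; split_ifs <;> simp
  map_smul' a b := by
    ext W; simp only [Pi.smul_apply, RingHom.id_apply]; split_ifs <;> simp [smul_comm a]

/-- exterior multiplication -/
def wed (w : ι) : Module.End S (Finset ι → Z) where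
  toFun z W := if w ∈ W then sg o S w W • z (W.erase w) else 0
  map_add' a b := by ext W; simp only [Pi.add_apply]; split_ifs <;> simp
  map_smul' a b := by
    ext W; simp only [Pi.smul_apply, RingHom.id_apply]; split_ifs <;> simp [smul_comm a]

/-- pointwise operators -/
def pt (a : Finset ι → Module.End S Z) : Module.End S (Finset ι → Z) where
  toFun z W := a W (z W)
  map_add' x y := by ext W; simp
  map_smul' x y := by ext W; simp

theorem con_apply (w : ι) (z : Finset ι → Z) (W : Finset ι) :
    con o (S := S) w z W = if w ∈ W then 0 else sg o S w W • z (insert w W) := rfl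
theorem wed_apply (w : ι) (z : Finset ι → Z) (W : Finset ι) :
    wed o (S := S) w z W = if w ∈ W then sg o S w W • z (W.erase w) else 0 := rfl
theorem pt_apply (a : Finset ι → Module.End S Z) (z : Finset ι → Z) (W : Finset ι) :
    pt a z W = a W (z W) := rfl

theorem con_sq (w : ι) : con o w * con o w = (0 : Module.End S (Finset ι → Z)) := by
  ext z W : 2
  simp [con_apply]

theorem con_con (ho : Function.Injective o) {w w' : ι} (h : w ≠ w') :
    con o w * con o w' + con o w' * con o w = (0 : Module.End S (Finset ι → Z)) := by
  ext z W : 2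
  simp only [LinearMap.add_apply, Module.End.mul_apply, Pi.add_apply, con_apply,
    LinearMap.zero_apply, Pi.zero_apply]
  by_cases h1 : w ∈ W
  · simp [h1]
  by_cases h2 : w' ∈ W
  · simp [h2]
  have h3 : w' ∉ insert w W := by simp [h2, h.symm]
  have h4 : w ∉ insert w' W := by simp [h1, h]
  rw [if_neg h1, if_neg h3, if_neg h2, if_neg h4, sg_insert o _ h1, sg_insert o _ h2,
    insert_comm w w']
  have := fun e => h (ho e)
  rcases lt_or_gt_of_ne this with h5 | h5
  · rw [if_pos h5, if_neg h5.not_gt]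
    simp only [smul_smul, ← add_smul]
    convert zero_smul S _ using 2
    ring
  · rw [if_pos h5, if_neg h5.not_gt]
    simp only [smul_smul, ← add_smul]
    convert zero_smul S _ using 2
    ring

theorem con_wed_self (w : ι) :
    con o w * wed o w + wed o w * con o w = (1 : Module.End S (Finset ι → Z)) := by
  ext z W : 2
  simp only [LinearMap.add_apply, Module.End.mul_apply, Pi.add_apply, con_apply, wed_apply,
    Module.End.one_apply]
  by_cases h1 : w ∈ W
  · simp [h1, smul_smul, sg_erase_self, sg_mul_self]
  · simp [h1, smul_smul, sg_insert_self, sg_mul_self]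

theorem con_wed (ho : Function.Injective o) {w w' : ι} (h : w ≠ w') :
    con o w * wed o w' + wed o w' * con o w = (0 : Module.End S (Finset ι → Z)) := by
  ext z W : 2
  simp only [LinearMap.add_apply, Module.End.mul_apply, Pi.add_apply, con_apply, wed_apply,
    LinearMap.zero_apply, Pi.zero_apply]
  by_cases h1 : w ∈ W
  · have : w ∈ W.erase w' := mem_erase.2 ⟨h, h1⟩
    simp [h1, this]
  by_cases h2 : w' ∈ W
  swap
  · have : w' ∉ insert w W := by simp [h2, h.symm]
    simp [h2, this]
  obtain ⟨W, h3, rfl⟩ : ∃ W', w' ∉ W' ∧ W = insert w' W' :=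
    ⟨W.erase w', by simp, by rw [insert_erase h2]⟩
  have h4 : w ∉ W := fun h => h1 (mem_insert_of_mem h)
  have h5 : w' ∉ insert w W := by simp [h3, h.symm]
  rw [insert_comm w w', erase_insert h5, erase_insert h3]
  simp only [h1, h4, mem_insert_self, if_true, if_false]
  rw [insert_comm w' w, sg_insert o w' (w' := w) (by simpa using h1), sg_insert o w h3,
    sg_insert_self]
  have := fun e => h (ho e)
  rcases lt_or_gt_of_ne this with h6 | h6
  · rw [if_pos h6, if_neg h6.not_gt]
    simp only [smul_smul, ← add_smul]
    convert zero_smul S _ using 2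
    ring
  · rw [if_pos h6, if_neg h6.not_gt]
    simp only [smul_smul, ← add_smul]
    convert zero_smul S _ using 2
    ring

theorem pt_mul_pt (a b : Finset ι → Module.End S Z) : pt a * pt b = pt (fun W => a W * b W) := rfl

theorem pt_con {a : Finset ι → Module.End S Z} {w : ι} (h : ∀ W, a (insert w W) = a W) :
    con o w * pt a = pt a * con o w := by
  ext z W : 2
  simp only [Module.End.mul_apply, con_apply, pt_apply]
  split_ifs
  · simp
  · simp [h]

theorem pt_wed {a : Finset ι → Module.End S Z} {w : ι} (h : ∀ W, a (insert w W) = a W) :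
    wed o w * pt a = pt a * wed o w := by
  ext z W : 2
  simp only [Module.End.mul_apply, wed_apply, pt_apply]
  split_ifs with h1
  · rw [map_smul, ← h (W.erase w), insert_erase h1]
  · simp

theorem sum_antisymm {α M : Type*} [Fintype α] [AddCommGroup M] (g : α → α → M)
    (h0 : ∀ a, g a a = 0) (h1 : ∀ a b, a ≠ b → g a b + g b a = 0) : ∑ a, ∑ b, g a b = 0 := by
  classical
  rw [← Finset.sum_product']
  refine Finset.sum_involution (fun p _ => (p.2, p.1)) ?_ ?_ ?_ ?_
  · rintro ⟨a, b⟩ _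
    by_cases h : a = b
    · subst h; simp [h0]
    · exact h1 a b h
  · rintro ⟨a, b⟩ _ h
    rintro h'
    simp only [Prod.mk.injEq] at h'
    exact h (by rw [h'.1]; exact h0 _)
  · simp
  · simp

/-- Koszul differential -/
def kos [Fintype ι] (c : ι → Module.End S Z) : Module.End S (Finset ι → Z) :=
  ∑ w, pt (fun _ => c w) * con o w

theorem kos_apply [Fintype ι] (c : ι → Module.End S Z) (z : Finset ι → Z) (W : Finset ι) :
    kos o c z W = ∑ w, c w (if w ∈ W then 0 else sg o S w W • z (insert w W)) := by
  unfold kos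
  rw [LinearMap.sum_apply, Finset.sum_apply]
  rfl

theorem kos_sq [Fintype ι] (ho : Function.Injective o) (c : ι → Module.End S Z)
    (hc : ∀ w w', c w * c w' = c w' * c w) : kos o c * kos o c = 0 := by
  unfold kos
  rw [Finset.sum_mul_sum]
  have e : ∀ w w', pt (fun _ => c w) * con o w * (pt (fun _ => c w') * con o w') =
      pt (fun _ => c w * c w') * (con o w * con o w') := by
    intro w w'
    rw [mul_assoc, ← mul_assoc (con o w), pt_con o (fun _ => rfl), ← pt_mul_pt]
    noncomm_ring
  simp only [e]
  apply sum_antisymm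
  · intro w; rw [con_sq, mul_zero]
  · intro w w' h
    rw [hc w' w, ← mul_add, con_con o ho h, mul_zero]

end Clifford

end PR

namespace PR
set_option linter.unusedSectionVars false
set_option linter.style.haveILetI false

/-! ### Laurent operators -/

section Laurent
variable (G : Type) [AddCommGroup G] (S : Type) [CommRing S]

/-- translation operators on functions -/
def shift : Multiplicative G →* Module.End S (G → S) where
  toFun β := { toFun := fun z α => z (α - β.toAdd), map_add' := fun _ _ => rfl,
               map_smul' := fun _ _ => rfl }
  map_one' := by ext z α : 2; simp
  map_mul' a b := by
    ext z α : 2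
    simp [sub_sub]

/-- the group algebra acts on functions on the group -/
def rho : AddMonoidAlgebra S G →ₐ[S] Module.End S (G → S) :=
  AddMonoidAlgebra.lift S (Module.End S (G → S)) G (shift G S)

variable {G S}

theorem rho_single (β : G) (a : S) (z : G → S) (α : G) :
    rho G S (AddMonoidAlgebra.single β a) z α = a * z (α - β) := by
  simp [rho, AddMonoidAlgebra.lift_single, shift]

theorem rho_comm (p q : AddMonoidAlgebra S G) : rho G S p * rho G S q = rho G S q * rho G S p := by
  rw [← map_mul, mul_comm, map_mul]

end Laurent

/-! ### The big Koszul-Cech complex -/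

section Setup
variable {n : ℕ} (m : Fin n → ℕ) (N : ℕ) {S : Type} [CommRing S] (x : Fin n → S)

abbrev VV : Type := Σ j : Fin n, Fin (m j + 1)
abbrev II : Type := VV m ⊕ Fin N
abbrev GG : Type := VV m → ℤ
abbrev LL (S : Type) [CommRing S] : Type := AddMonoidAlgebra S (GG m)
abbrev FF (S : Type) [CommRing S] : Type := Finset (II m N) → GG m → S

def ord : II m N → ℕ := fun w => (Fintype.equivFin _ w : ℕ)

theorem ord_inj : Function.Injective (ord m N) :=
  Fin.val_injective.comp (Fintype.equivFin _).injective

/-- multilinear forms: coefficients of a product of generating polynomials -/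
def ff {A : Type} [CommRing A] (x : Fin n → A) (y : VV m → A) (k : ℕ) : A :=
  ∑ i : Fin n, ∑ u : (∀ j, Fin (m j + 1)),
    if (i : ℕ) + ∑ j, (u j : ℕ) = k then x i * ∏ j, y ⟨j, u j⟩ else 0

theorem map_ff {A B : Type} [CommRing A] [CommRing B] (φ : A →+* B) (x : Fin n → A)
    (y : VV m → A) (k : ℕ) : φ (ff m x y k) = ff m (fun i => φ (x i)) (fun v => φ (y v)) k := by
  simp only [ff, map_sum, apply_ite φ, map_mul, map_prod, map_zero]

def yexp (u : ∀ j, Fin (m j + 1)) : GG m := ∑ j, Pi.single ⟨j, u j⟩ 1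

variable (S) in
def yv (v : VV m) : LL m S := AddMonoidAlgebra.single (Pi.single v 1) 1

variable {m} in
def fL (k : ℕ) : LL m S := ff m (fun i => algebraMap S (LL m S) (x i)) (yv m S) k

theorem single_prod {A : Type*} (s : Finset A) (g : A → GG m) :
    ∏ a ∈ s, (AddMonoidAlgebra.single (g a) 1 : LL m S) =
      AddMonoidAlgebra.single (∑ a ∈ s, g a) 1 := by
  classical
  induction s using Finset.induction_on with
  | empty => simp [AddMonoidAlgebra.one_def]
  | insert a s ha ih => rw [prod_insert ha, sum_insert ha, ih, AddMonoidAlgebra.single_mul_single,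
      one_mul]

theorem rho_fL (k : ℕ) (z : GG m → S) (α : GG m) :
    rho (GG m) S (fL x k) z α = ∑ i : Fin n, ∑ u : (∀ j, Fin (m j + 1)),
      if (i : ℕ) + ∑ j, (u j : ℕ) = k then x i * z (α - yexp m u) else 0 := by
  simp only [fL, ff, map_sum, LinearMap.sum_apply, Finset.sum_apply]
  refine sum_congr rfl fun i _ => sum_congr rfl fun u _ => ?_
  split_ifs
  · simp only [yv]
    rw [single_prod, map_mul, AlgHom.commutes, Module.End.mul_apply]
    simp only [Module.algebraMap_end_apply, Pi.smul_apply, rho_single, one_mul, smul_eq_mul]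
    rfl
  · simp

variable {m N} in
def cc : II m N → LL m S := Sum.elim (fun _ => 1) (fun k => fL x k)

variable {m N} in
/-- the big differential -/
def DD : Module.End S (FF m N S) := kos (ord m N) (fun w => rho (GG m) S (cc x w))

theorem DD_sq : DD x * DD x = (0 : Module.End S (FF m N S)) :=
  kos_sq _ (ord_inj m N) _ fun _ _ => rho_comm _ _

theorem DD_apply (z : FF m N S) (W : Finset (II m N)) (α : GG m) :
    DD x z W α = (∑ v : VV m, if Sum.inl v ∈ W then 0 else
        sg (ord m N) S (Sum.inl v) W * z (insert (Sum.inl v) W) α) +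
      ∑ k : Fin N, if Sum.inr k ∈ W then 0 else
        sg (ord m N) S (Sum.inr k) W * ∑ i : Fin n, ∑ u : (∀ j, Fin (m j + 1)),
      if (i : ℕ) + ∑ j, (u j : ℕ) = k then
        x i * z (insert (Sum.inr k) W) (α - yexp m u) else 0 := by
  rw [DD, kos_apply, Finset.sum_apply, Fintype.sum_sum_type]
  congr 1
  · refine sum_congr rfl fun v _ => ?_
    simp only [cc, Sum.elim_inl, map_one, Module.End.one_apply]
    split_ifs <;> simp
  · refine sum_congr rfl fun k _ => ?_
    simp only [cc, Sum.elim_inr]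
    split_ifs
    · simp
    · rw [map_smul, Pi.smul_apply, rho_fL, smul_eq_mul]

theorem DD_graded (Q Q' : Finset (II m N) → GG m → AddSubgroup S)
    (h1 : ∀ W v α, Sum.inl v ∉ W → Q (insert (Sum.inl v) W) α ≤ Q' W α)
    (h2 : ∀ W k α u i, Sum.inr k ∉ W → ∀ a ∈ Q (insert (Sum.inr k) W) (α - yexp m u),
      x i * a ∈ Q' W α)
    (z : FF m N S) (hz : ∀ W α, z W α ∈ Q W α) (W : Finset (II m N)) (α : GG m) :
    DD x z W α ∈ Q' W α := by
  have hs : ∀ w, ∀ a ∈ Q' W α, sg (ord m N) S w W * a ∈ Q' W α := by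
    intro w a ha
    rcases neg_one_pow_eq_or S (W.filter (fun u => ord m N u < ord m N w)).card with h | h
    · rw [sg, h, one_mul]; exact ha
    · rw [sg, h, neg_one_mul]; exact neg_mem ha
  rw [DD_apply]
  refine add_mem (sum_mem fun v _ => ?_) (sum_mem fun k _ => ?_)
  · split_ifs with h
    · exact zero_mem _
    · exact hs _ _ (h1 _ _ _ h (hz _ _))
  · split_ifs with h
    · exact zero_mem _
    · refine hs _ _ (sum_mem fun i _ => sum_mem fun u _ => ?_)
      split_ifs
      · exact h2 _ _ _ _ _ h _ (hz _ _)
      · exact zero_mem _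

/-- valid cells -/
def valid (W : Finset (II m N)) (α : GG m) : Prop :=
  (∀ v, Sum.inl v ∈ W → 0 ≤ α v) ∧ ∀ j, ∃ t, Sum.inl ⟨j, t⟩ ∉ W

open Classical in
variable (S) in
def PP : Module.End S (FF m N S) where
  toFun z W α := if valid m N W α then z W α else 0
  map_add' a b := by ext W α; simp only [Pi.add_apply]; split_ifs <;> simp
  map_smul' a b := by
    ext W α; simp only [Pi.smul_apply, RingHom.id_apply]; split_ifs <;> simp

theorem PP_apply (z : FF m N S) (W : Finset (II m N)) (α : GG m) [Decidable (valid m N W α)] :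
    PP m N S z W α = if valid m N W α then z W α else 0 := by
  simp only [PP, LinearMap.coe_mk, AddHom.coe_mk]
  congr

theorem PP_eq_iff (z : FF m N S) :
    PP m N S z = z ↔ ∀ W α, ¬ valid m N W α → z W α = 0 := by
  classical
  constructor
  · intro h W α hv
    rw [← h, PP_apply, if_neg hv]
  · intro h
    ext W α
    rw [PP_apply]
    split_ifs with hv
    · rfl
    · rw [h W α hv]

theorem PP_sq : PP m N S * PP m N S = PP m N S := by
  classical
  refine LinearMap.ext fun z => ?_
  ext W α
  simp only [Module.End.mul_apply, PP_apply]
  split_ifs <;> rfl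

theorem yexp_nonneg (u : ∀ j, Fin (m j + 1)) (v : VV m) : 0 ≤ yexp m u v := by
  rw [yexp, Finset.sum_apply]
  refine sum_nonneg fun j _ => ?_
  rw [Pi.single_apply]; split_ifs <;> simp

theorem PDP : PP m N S * (DD x * PP m N S) = DD x * PP m N S := by
  classical
  refine LinearMap.ext fun z => ?_
  simp only [Module.End.mul_apply]
  rw [PP_eq_iff]
  intro W α hv
  let Q : Finset (II m N) → GG m → AddSubgroup S := fun W α => if valid m N W α then ⊤ else ⊥
  have := DD_graded m N x Q Q ?_ ?_ (PP m N S z) ?_ W α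
  · simpa [Q, hv] using this
  · intro W v α hv a ha
    simp only [Q] at *
    split_ifs with h1
    · trivial
    · rw [if_neg] at ha
      · exact ha
      · rintro ⟨h2, h3⟩
        exact h1 ⟨fun v hv => h2 v (mem_insert_of_mem hv),
          fun j => (h3 j).imp fun t ht h => ht (mem_insert_of_mem h)⟩
  · intro W k α u i hk a ha
    simp only [Q] at *
    split_ifs with h1
    · trivial
    · rw [if_neg] at ha
      · simp only [AddSubgroup.mem_bot] at ha ⊢
        rw [ha, mul_zero]
      · rintro ⟨h2, h3⟩
        refine h1 ⟨fun v hv => ?_, fun j => (h3 j).imp fun t ht h => ht (mem_insert_of_mem h)⟩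
        have := h2 v (mem_insert_of_mem hv)
        have h4 := yexp_nonneg m u v
        simp only [Pi.sub_apply] at this
        omega
  · intro W α
    rw [PP_apply]
    simp only [Q]
    split_ifs <;> simp

end Setup
end PR

namespace PR
set_option linter.unusedSectionVars false
set_option linter.style.haveILetI false

/-! ### Torsion of the homology of the big complex -/

section Torsion
variable {n : ℕ} (m : Fin n → ℕ) (N : ℕ)

theorem ff_zero {A : Type} [CommRing A] [IsDomain A] (hN : n + ∑ j, m j ≤ N) (x : Fin n → A)
    (y : VV m → A) (h : ∀ k : Fin N, ff m x y k = 0) (i : Fin n) (t : ∀ j, Fin (m j + 1)) :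
    x i * ∏ j, y ⟨j, t j⟩ = 0 := by
  classical
  have e : (∑ i : Fin n, Polynomial.monomial (i : ℕ) (x i)) *
      ∏ j, ∑ s : Fin (m j + 1), Polynomial.monomial (s : ℕ) (y ⟨j, s⟩) = 0 := by
    rw [Finset.prod_univ_sum, Finset.sum_mul_sum]
    ext k
    rw [Polynomial.finsetSum_coeff, Polynomial.coeff_zero]
    simp only [Polynomial.finsetSum_coeff]
    have e1 : ∀ (i : Fin n) (u : ∀ j, Fin (m j + 1)),
        ((Polynomial.monomial (i : ℕ) (x i)) *
          ∏ j, Polynomial.monomial (u j : ℕ) (y ⟨j, u j⟩)).coeff k =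
        if (i : ℕ) + ∑ j, (u j : ℕ) = k then x i * ∏ j, y ⟨j, u j⟩ else 0 := by
      intro i u
      have : ∀ s : Finset (Fin n), ∏ j ∈ s, Polynomial.monomial (u j : ℕ) (y ⟨j, u j⟩) =
          Polynomial.monomial (∑ j ∈ s, (u j : ℕ)) (∏ j ∈ s, y ⟨j, u j⟩) := by
        intro s
        induction s using Finset.induction_on with
        | empty => simp
        | insert a s ha ih => rw [prod_insert ha, sum_insert ha, prod_insert ha, ih,
            Polynomial.monomial_mul_monomial]
      rw [this, Polynomial.monomial_mul_monomial, Polynomial.coeff_monomial]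
    simp only [e1, Fintype.piFinset_univ]
    by_cases hk : k < N
    · exact h ⟨k, hk⟩
    · refine sum_eq_zero fun i _ => sum_eq_zero fun u _ => if_neg ?_
      have : ∑ j, (u j : ℕ) ≤ ∑ j, m j := sum_le_sum fun j _ => Nat.lt_succ_iff.1 (u j).2
      have := i.2
      omega
  have cf : ∀ (r : ℕ) (g : Fin r → A) (i : Fin r),
      (∑ s : Fin r, Polynomial.monomial (s : ℕ) (g s)).coeff i = g i := by
    intro r g i
    rw [Polynomial.finsetSum_coeff]
    simp only [Polynomial.coeff_monomial]
    rw [Finset.sum_eq_single i]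
    · simp
    · intro b _ hb; rw [if_neg]; exact fun h => hb (Fin.ext h)
    · simp
  rcases mul_eq_zero.1 e with e | e
  · rw [← cf n x i, e]; simp
  · rw [prod_eq_zero_iff] at e
    obtain ⟨j, _, e⟩ := e
    have : y ⟨j, t j⟩ = 0 := by
      rw [← cf (m j + 1) (fun s => y ⟨j, s⟩) (t j), e]; simp
    rw [prod_eq_zero (mem_univ j) this, mul_zero]

variable {S : Type} [CommRing S] (x : Fin n → S)

theorem exists_pow [IsNoetherianRing S] (hN : n + ∑ j, m j ≤ N) (i : Fin n) :
    ∃ e : ℕ, ∀ t : (∀ j, Fin (m j + 1)), ∃ c : Fin N → MvPolynomial (VV m) S,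
      ∑ k, c k * ff m (fun i => C (x i)) (X : VV m → MvPolynomial (VV m) S) k =
        (C (x i) * ∏ j, X ⟨j, t j⟩) ^ e := by
  let J : Ideal (MvPolynomial (VV m) S) := Ideal.span (Set.range fun k : Fin N =>
    ff m (fun i => C (x i)) (X : VV m → MvPolynomial (VV m) S) k)
  obtain ⟨e, he⟩ := Ideal.exists_radical_pow_le_of_fg J (IsNoetherian.noetherian _)
  refine ⟨e, fun t => ?_⟩
  rw [← Ideal.mem_span_range_iff_exists_fun]
  apply he
  apply Ideal.pow_mem_pow
  rw [Ideal.radical_eq_sInf, Submodule.mem_sInf]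
  rintro P ⟨hP, hp⟩
  rw [← Ideal.Quotient.eq_zero_iff_mem]
  have : Ideal.IsPrime P := hp
  have := ff_zero m N hN (fun i => Ideal.Quotient.mk P (C (x i)))
    (fun v => Ideal.Quotient.mk P (X v)) (fun k => by
      rw [← map_ff, Ideal.Quotient.eq_zero_iff_mem]
      exact hP (Ideal.subset_span ⟨k, rfl⟩)) i t
  rw [map_mul, map_prod]
  exact this

/-- functions vanishing at exponents that are negative at some place of `U` -/
def Zpos (U : Finset (VV m)) (z : GG m → S) : Prop := ∀ α : GG m, (∃ v ∈ U, α v < 0) → z α = 0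

def pos (U : Finset (VV m)) (a : LL m S) : Prop := ∀ z, Zpos m U z → Zpos m U (rho (GG m) S a z)

theorem pos_mul {U : Finset (VV m)} {a b : LL m S} (ha : pos m U a) (hb : pos m U b) :
    pos m U (a * b) := by
  intro z hz
  rw [map_mul, Module.End.mul_apply]
  exact ha _ (hb _ hz)

theorem pos_add {U : Finset (VV m)} {a b : LL m S} (ha : pos m U a) (hb : pos m U b) :
    pos m U (a + b) := by
  intro z hz α h
  rw [map_add, LinearMap.add_apply, Pi.add_apply, ha z hz α h, hb z hz α h, add_zero]

theorem pos_single {U : Finset (VV m)} (β : GG m) (hβ : ∀ v ∈ U, 0 ≤ β v) (s : S) :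
    pos m U (AddMonoidAlgebra.single β s) := by
  rintro z hz α ⟨v, hv, h⟩
  rw [rho_single, hz, mul_zero]
  refine ⟨v, hv, ?_⟩
  have := hβ v hv
  simp only [Pi.sub_apply]; omega

theorem pos_aeval (U : Finset (VV m)) (p : MvPolynomial (VV m) S) : pos m U (aeval (yv m S) p) := by
  induction p using MvPolynomial.induction_on with
  | C a =>
    rw [aeval_C]
    intro z hz α h
    rw [AlgHom.commutes, Module.algebraMap_end_apply, Pi.smul_apply, hz α h, smul_zero]
  | add p q hp hq => rw [map_add]; exact pos_add m hp hq
  | mul_X p v hp =>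
    rw [map_mul, aeval_X]
    refine pos_mul m hp (pos_single m _ (fun w _ => ?_) _)
    rw [Pi.single_apply]; split_ifs <;> simp

theorem exists_a [IsNoetherianRing S] (hN : n + ∑ j, m j ≤ N) (i : Fin n) :
    ∃ e : ℕ, ∃ a : Finset (VV m) → Fin N → LL m S, ∀ U, (∀ k, pos m U (a U k)) ∧
      ((∀ j, ∃ t, (⟨j, t⟩ : VV m) ∉ U) →
        ∑ k, a U k * fL x k = algebraMap S (LL m S) (x i ^ e)) := by
  classical
  obtain ⟨e, he⟩ := exists_pow m N x hN i
  refine ⟨e, ?_⟩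
  have : ∀ U : Finset (VV m), ∃ b : Fin N → LL m S, (∀ k, pos m U (b k)) ∧
      ((∀ j, ∃ t, (⟨j, t⟩ : VV m) ∉ U) →
        ∑ k, b k * fL x k = algebraMap S (LL m S) (x i ^ e)) := by
    intro U
    by_cases hU : ∀ j, ∃ t, (⟨j, t⟩ : VV m) ∉ U
    swap
    · refine ⟨fun _ => 0, fun k z hz α h => by simp, fun h => absurd h hU⟩
    choose t ht using hU
    obtain ⟨c, hc⟩ := he t
    refine ⟨fun k => AddMonoidAlgebra.single (-(e • yexp m t)) 1 * aeval (yv m S) (c k),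
      fun k => pos_mul m (pos_single m _ (fun v hv => ?_) _) (pos_aeval m U _), fun _ => ?_⟩
    · have : yexp m t v = 0 := by
        rw [yexp, Finset.sum_apply]
        refine sum_eq_zero fun j _ => ?_
        rw [Pi.single_apply, if_neg]
        rintro rfl
        exact ht j hv
      simp [this]
    · have h1 := congrArg (aeval (yv m S)) hc
      simp only [map_sum, map_mul, map_pow, map_prod, aeval_C, aeval_X] at h1
      have h2 : ∀ k : Fin N, aeval (yv m S) (ff m (fun i => C (x i))
          (X : VV m → MvPolynomial (VV m) S) k) = fL x k := by
        intro k
        have := map_ff m (aeval (yv m S) : MvPolynomial (VV m) S →ₐ[S] LL m S).toRingHom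
          (fun i => C (x i)) X k
        simp only [AlgHom.toRingHom_eq_coe, RingHom.coe_coe, aeval_C, aeval_X] at this
        exact this
      simp only [h2] at h1
      simp only [mul_assoc]
      rw [← mul_sum, h1]
      simp only [yv]
      rw [single_prod, mul_pow, AddMonoidAlgebra.single_pow, mul_left_comm,
        AddMonoidAlgebra.single_mul_single, map_pow]
      have : (-(e • yexp m t) + e • ∑ j, Pi.single (⟨j, t j⟩ : VV m) (1 : ℤ)) = 0 := by
        rw [yexp]; simp
      rw [this, one_pow, one_mul, ← AddMonoidAlgebra.one_def, mul_one]
  choose a ha using this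
  exact ⟨a, ha⟩

variable {m N} in
def UW (W : Finset (II m N)) : Finset (VV m) := univ.filter fun v => Sum.inl v ∈ W

variable {m N} in
theorem UW_inr (W : Finset (II m N)) (k : Fin N) : UW (insert (Sum.inr k) W) = UW W := by
  ext v; simp [UW]

variable {m N} in
theorem UW_inr' (W : Finset (II m N)) (k : Fin N) : UW (W.erase (Sum.inr k)) = UW W := by
  ext v; simp [UW]

variable {m N} in
theorem UW_inl (W : Finset (II m N)) (v : VV m) (h : Sum.inl v ∉ W) :
    (UW (insert (Sum.inl v) W)).card = (UW W).card + 1 := by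
  have : UW (insert (Sum.inl v) W) = insert v (UW W) := by
    ext v; simp [UW]
  rw [this, card_insert_of_notMem]
  simpa [UW] using h

theorem torsion [IsNoetherianRing S] (hN : n + ∑ j, m j ≤ N) (i : Fin n) :
    ∃ M : ℕ, ∀ z : FF m N S, PP m N S z = z → DD x z = 0 →
      ∃ w, x i ^ M • z = DD x (PP m N S w) := by
  classical
  obtain ⟨e, a, ha⟩ := exists_a m N x hN i
  let A : Fin N → Module.End S (FF m N S) := fun k => pt (fun W => rho (GG m) S (a (UW W) k))
  let F : Fin N → Module.End S (FF m N S) := fun k => pt (fun W => rho (GG m) S (fL x k))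
  let ck : Fin N → Module.End S (FF m N S) := fun k => con (ord m N) (Sum.inr k)
  let wk : Fin N → Module.End S (FF m N S) := fun k => wed (ord m N) (Sum.inr k)
  let s : Module.End S (FF m N S) := ∑ k, A k * wk k
  let DK : Module.End S (FF m N S) := ∑ k, F k * ck k
  let DC : Module.End S (FF m N S) := ∑ v : VV m, con (ord m N) (Sum.inl v)
  have hD : DD x = DC + DK := by
    simp only [DD, kos, Fintype.sum_sum_type, DC, DK, F, ck, cc, Sum.elim_inl, Sum.elim_inr]
    congr 1
    refine sum_congr rfl fun v _ => ?_
    rw [map_one]; rfl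
  have hFA : ∀ k l, F l * A k = A k * F l := fun k l => by
    simp only [F, A, pt_mul_pt, rho_comm]
  have hcA : ∀ k l, ck l * A k = A k * ck l := fun k l => pt_con _ fun W => by rw [UW_inr]
  have hwF : ∀ k l, wk k * F l = F l * wk k := fun k l => pt_wed _ fun W => rfl
  have hcw : ∀ k l, ck l * wk k + wk k * ck l = if k = l then 1 else 0 := by
    intro k l
    split_ifs with h
    · subst h; exact con_wed_self _ _
    · exact con_wed _ (ord_inj m N) (by simpa using Ne.symm h)
  have hKs : DK * s + s * DK = ∑ k, A k * F k := by
    simp only [DK, s, sum_mul_sum]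
    rw [sum_comm, ← sum_add_distrib]
    refine sum_congr rfl fun k _ => ?_
    rw [← sum_add_distrib]
    have : ∀ l, F l * ck l * (A k * wk k) + A k * wk k * (F l * ck l) =
        A k * F l * (if k = l then 1 else 0) := by
      intro l
      rw [← hcw, mul_add]
      calc _ = F l * (ck l * A k) * wk k + A k * (wk k * F l) * ck l := by noncomm_ring
        _ = (F l * A k) * ck l * wk k + A k * (F l * wk k) * ck l := by
          rw [hcA, hwF]; noncomm_ring
        _ = _ := by rw [hFA]; noncomm_ring
    simp only [this]
    simp
  let Θ : ℕ → FF m N S → Prop := fun b z => ∀ W, b ≤ (UW W).card → z W = 0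
  have hDC : ∀ b z, Θ (b + 1) z → Θ b (DC z) := by
    intro b z hz W hW
    simp only [DC]
    rw [LinearMap.sum_apply, Finset.sum_apply]
    refine sum_eq_zero fun v _ => ?_
    rw [con_apply]
    split_ifs with h
    · rfl
    · rw [hz _ (by rw [UW_inl _ _ h]; omega), smul_zero]
  have hs : ∀ z W, s z W = ∑ k, rho (GG m) S (a (UW W) k)
      (if Sum.inr k ∈ W then sg (ord m N) S (Sum.inr k) W • z (W.erase (Sum.inr k)) else 0) := by
    intro z W
    simp only [s]
    rw [LinearMap.sum_apply, Finset.sum_apply]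
    rfl
  have hsΘ : ∀ b z, Θ b z → Θ b (s z) := by
    intro b z hz W hW
    rw [hs]
    refine sum_eq_zero fun k _ => ?_
    split_ifs
    · rw [hz _ (by rwa [UW_inr']), smul_zero, map_zero]
    · rw [map_zero]
  have hval : ∀ W α, valid m N W α ↔ ((∀ v ∈ UW W, 0 ≤ α v) ∧ ∀ j, ∃ t, ⟨j, t⟩ ∉ UW W) := by
    intro W α
    simp [valid, UW]
  have hPs : ∀ z, PP m N S z = z → PP m N S (s z) = s z := by
    intro z hz
    rw [PP_eq_iff] at hz ⊢
    intro W α hv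
    rw [hs, Finset.sum_apply]
    refine sum_eq_zero fun k _ => ?_
    split_ifs
    swap
    · simp
    rw [map_smul, Pi.smul_apply]
    rw [hval] at hv
    by_cases h2 : ∀ j, ∃ t, ⟨j, t⟩ ∉ UW W
    · rw [(ha (UW W)).1 k, smul_zero]
      · rintro β ⟨v, hv1, hv2⟩
        apply hz
        rw [hval, UW_inr']
        rintro ⟨h3, _⟩
        exact absurd (h3 v hv1) (not_le.2 hv2)
      · by_contra h3
        push Not at h3
        exact hv ⟨h3, h2⟩
    · have : z (W.erase (Sum.inr k)) = 0 := by
        ext β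
        apply hz
        rw [hval, UW_inr']
        exact fun h => h2 h.2
      rw [this]; simp
  have hg : ∀ z, PP m N S z = z → (∑ k, A k * F k) z = x i ^ e • z := by
    intro z hz
    funext W
    rw [LinearMap.sum_apply, Finset.sum_apply]
    have : ∀ k, (A k * F k) z W = rho (GG m) S (a (UW W) k * fL x k) (z W) := by
      intro k; rw [map_mul]; rfl
    simp only [this]
    rw [← LinearMap.sum_apply, ← map_sum]
    by_cases h2 : ∀ j, ∃ t, ⟨j, t⟩ ∉ UW W
    · rw [(ha _).2 h2, AlgHom.commutes]; rfl
    · have : z W = 0 := by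
        ext β
        rw [PP_eq_iff] at hz
        apply hz
        rw [hval]
        exact fun h => h2 h.2
      rw [Pi.smul_apply, this]; simp
  have main : ∀ b z, PP m N S z = z → DD x z = 0 → Θ b z →
      ∃ w, (x i ^ e) ^ b • z = DD x (PP m N S w) := by
    intro b
    induction b with
    | zero =>
      intro z _ _ h
      have : z = 0 := by funext W; exact h W (Nat.zero_le _)
      exact ⟨0, by simp [this]⟩
    | succ b ih =>
      intro z hPz hDz hz
      have e1 : x i ^ e • z = DD x (s z) - (DC (s z) + s (DC z)) := by
        rw [← hg z hPz, ← hKs]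
        have : s (DD x z) = 0 := by rw [hDz, map_zero]
        rw [hD] at this ⊢
        simp only [LinearMap.add_apply, Module.End.mul_apply, map_add] at this ⊢
        rw [← sub_eq_zero, ← this]; abel
      have e2 : DC (s z) + s (DC z) = DD x (s z) - x i ^ e • z := by rw [e1]; abel
      obtain ⟨w, hw⟩ := ih (DC (s z) + s (DC z)) (by
          rw [e2, map_sub, map_smul, hPz]
          congr 1
          have := LinearMap.congr_fun (PDP m N x) (s z)
          simp only [Module.End.mul_apply, hPs z hPz] at this
          exact this) (by
          rw [e2, map_sub, map_smul, hDz, smul_zero, sub_zero]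
          exact LinearMap.congr_fun (DD_sq m N x) (s z))
        (by
          intro W hW
          have h1 := hDC b _ (hsΘ _ _ hz) W hW
          have h2 := hsΘ b _ (hDC b _ hz) W hW
          rw [Pi.add_apply, h1, h2, add_zero])
      refine ⟨(x i ^ e) ^ b • s z - w, ?_⟩
      rw [map_sub, map_sub, ← hw, map_smul, map_smul, hPs z hPz, pow_succ, mul_smul, e1, smul_sub]
  refine ⟨e * ((univ : Finset (VV m)).card + 1), fun z h1 h2 => ?_⟩
  rw [pow_mul]
  refine main _ z h1 h2 fun W hW => ?_
  have := card_le_univ (UW W)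
  rw [Finset.card_univ] at hW
  omega

end Torsion
end PR

namespace PR
set_option linter.unusedSectionVars false
set_option linter.style.haveILetI false

/-! ### The discrete Morse matching -/

section Matching
variable {n : ℕ} {m : Fin n → ℕ} {N : ℕ} 

def critj (W : Finset (II m N)) (α : GG m) (j : Fin n) : Prop :=
  (∀ t, α ⟨j, t⟩ < 0) ∨ ((∀ t, 0 ≤ α ⟨j, t⟩) ∧ ∀ t, Sum.inl ⟨j, t⟩ ∈ W ↔ t ≠ 0)

open Classical in
def tau (α : GG m) (j : Fin n) : Fin (m j + 1) :=
  if h : ∃ t, 0 ≤ α ⟨j, t⟩ then (if 0 ≤ α ⟨j, 0⟩ then 0 else h.choose) else 0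

theorem tau_nonneg {α : GG m} {j : Fin n} (h : ∃ t, 0 ≤ α ⟨j, t⟩) : 0 ≤ α ⟨j, tau α j⟩ := by
  unfold tau
  rw [dif_pos h]
  split_ifs with h1
  · exact h1
  · exact h.choose_spec

theorem tau_zero {α : GG m} {j : Fin n} (h : 0 ≤ α ⟨j, 0⟩) : tau α j = 0 := by
  unfold tau
  rw [dif_pos ⟨0, h⟩, if_pos h]

open Classical in
def ncrit (W : Finset (II m N)) (α : GG m) : Finset (Fin n) := univ.filter fun j => ¬ critj W α j

open Classical in
def star (W : Finset (II m N)) (α : GG m) : Option (VV m) :=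
  if h : (ncrit W α).Nonempty then some ⟨(ncrit W α).min' h, tau α ((ncrit W α).min' h)⟩ else none

theorem mem_ncrit {W : Finset (II m N)} {α : GG m} {j : Fin n} :
    j ∈ ncrit W α ↔ ¬ critj W α j := by simp [ncrit]

theorem star_none_iff {W : Finset (II m N)} {α : GG m} :
    star W α = none ↔ ∀ j, critj W α j := by
  unfold star
  split_ifs with h
  · obtain ⟨j, hj⟩ := h
    rw [mem_ncrit] at hj
    simp only [reduceCtorEq, false_iff]
    exact fun h => hj (h j)
  · simp only [true_iff]
    intro j
    by_contra hj
    exact h ⟨j, mem_ncrit.2 hj⟩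

theorem star_some {W : Finset (II m N)} {α : GG m} {v : VV m} (h : star W α = some v) :
    ¬ critj W α v.1 ∧ (∀ j < v.1, critj W α j) ∧ v = ⟨v.1, tau α v.1⟩ := by
  unfold star at h
  split_ifs at h with h1
  simp only [Option.some.injEq] at h
  subst h
  refine ⟨mem_ncrit.1 (min'_mem _ h1), fun j hj => ?_, rfl⟩
  by_contra hc
  exact absurd (min'_le _ _ (mem_ncrit.2 hc)) (not_le.2 hj)

theorem star_of {W : Finset (II m N)} {α : GG m} {j : Fin n} (h1 : ¬ critj W α j)
    (h2 : ∀ i < j, critj W α i) : star W α = some ⟨j, tau α j⟩ := by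
  have hne : (ncrit W α).Nonempty := ⟨j, mem_ncrit.2 h1⟩
  have : (ncrit W α).min' hne = j := by
    apply le_antisymm
    · exact min'_le _ _ (mem_ncrit.2 h1)
    · by_contra hc
      exact mem_ncrit.1 (min'_mem _ hne) (h2 _ (not_le.1 hc))
  unfold star
  rw [dif_pos hne, this]

theorem star_some_nonneg {W : Finset (II m N)} {α : GG m} {v : VV m} (h : star W α = some v) :
    0 ≤ α v := by
  obtain ⟨h1, _, h3⟩ := star_some h
  rw [h3]
  apply tau_nonneg
  by_contra hc
  push Not at hc
  exact h1 (Or.inl hc)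

theorem critj_insert {W : Finset (II m N)} {α : GG m} {v : VV m} {j : Fin n} (h : j ≠ v.1) :
    critj (insert (Sum.inl v) W) α j ↔ critj W α j := by
  unfold critj
  have : ∀ t, (⟨j, t⟩ : VV m) ≠ v := fun t e => h (by rw [← e])
  simp [this]

theorem critj_inr {W : Finset (II m N)} {α : GG m} {k : Fin N} {j : Fin n} :
    critj (insert (Sum.inr k) W) α j ↔ critj W α j := by
  unfold critj
  simp

theorem valid_of_insert {W : Finset (II m N)} {α : GG m} {w : II m N}
    (h : valid m N (insert w W) α) : valid m N W α :=
  ⟨fun v hv => h.1 v (mem_insert_of_mem hv),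
    fun j => (h.2 j).imp fun _ ht h => ht (mem_insert_of_mem h)⟩

theorem tog_valid {W : Finset (II m N)} {α : GG m} {v : VV m} (hv : Sum.inl v ∉ W)
    (h : valid m N W α) (hs : star W α = some v) : valid m N (insert (Sum.inl v) W) α := by
  have h0 := star_some_nonneg hs
  obtain ⟨h1, _, h3⟩ := star_some hs
  obtain ⟨j, t⟩ := v
  simp only at h1 h3
  refine ⟨fun w hw => ?_, fun i => ?_⟩
  · rcases mem_insert.1 hw with e | e
    · rw [Sum.inl.injEq] at e; rw [e]; exact h0
    · exact h.1 w e
  · by_cases hi : i = j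
    · subst hi
      by_contra hc
      push Not at hc
      have hc' : ∀ s, s ≠ t → Sum.inl ⟨i, s⟩ ∈ W := fun s hs => by
        have := hc s
        simpa [hs] using this
      have h4 : ∀ s, 0 ≤ α ⟨i, s⟩ := fun s => by
        by_cases e : s = t
        · rw [e]; exact h0
        · exact h.1 _ (hc' s e)
      have h5 : t = 0 := by
        have := tau_zero (h4 0)
        rw [this] at h3
        simpa using h3
      subst h5
      exact h1 (Or.inr ⟨h4, fun s => ⟨fun hs e => hv (e ▸ hs), hc' s⟩⟩)
    · obtain ⟨s, hs⟩ := h.2 i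
      refine ⟨s, ?_⟩
      simp [hs, hi]

theorem tog_star {W : Finset (II m N)} {α : GG m} {v : VV m} (hv : Sum.inl v ∉ W)
    (h : valid m N W α) (hs : star W α = some v) : star (insert (Sum.inl v) W) α = some v := by
  have h0 := star_some_nonneg hs
  obtain ⟨h1, h2, h3⟩ := star_some hs
  have goal : star (insert (Sum.inl v) W) α = some ⟨v.1, tau α v.1⟩ := ?_
  · rw [← h3] at goal; exact goal
  apply star_of
  · rintro (h4 | ⟨h4, h5⟩)
    · have := h4 v.2
      exact absurd h0 (not_le.2 this)
    · have h6 := tau_zero (h4 0)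
      rw [h6] at h3
      have := (h5 0).1 (by rw [← h3]; exact mem_insert_self _ _)
      exact this rfl
  · intro i hi
    rw [critj_insert hi.ne]
    exact h2 i hi

theorem tog_star' {W : Finset (II m N)} {α : GG m} {v : VV m} (hv : Sum.inl v ∉ W)
    (h : valid m N (insert (Sum.inl v) W) α) (hs : star (insert (Sum.inl v) W) α = some v) :
    star W α = some v := by
  have h0 := star_some_nonneg hs
  obtain ⟨h1, h2, h3⟩ := star_some hs
  rw [h3]
  apply star_of
  · rintro (h4 | ⟨h4, h5⟩)
    · have := h4 v.2
      exact absurd h0 (not_le.2 this)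
    · have h6 := tau_zero (h4 0)
      rw [h6] at h3
      obtain ⟨t, ht⟩ := h.2 v.1
      by_cases e : t = 0
      · subst e; rw [← h3] at ht; exact ht (mem_insert_self _ _)
      · exact ht (mem_insert_of_mem ((h5 t).2 e))
  · intro i hi
    rw [← critj_insert hi.ne]
    exact h2 i hi

/-- lower cells of the matching -/
def low (W : Finset (II m N)) (α : GG m) : Prop :=
  valid m N W α ∧ ∃ v, star W α = some v ∧ Sum.inl v ∈ W

def upp (W : Finset (II m N)) (α : GG m) : Prop :=
  valid m N W α ∧ ∃ v, star W α = some v ∧ Sum.inl v ∉ W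

def crt (W : Finset (II m N)) (α : GG m) : Prop :=
  valid m N W α ∧ star W α = none

theorem low_not_upp {W : Finset (II m N)} {α : GG m} (h : low W α) : ¬ upp W α := by
  rintro ⟨_, v, h1, h2⟩
  obtain ⟨_, w, h3, h4⟩ := h
  rw [h1, Option.some.injEq] at h3
  exact h2 (h3 ▸ h4)

theorem crt_not_upp {W : Finset (II m N)} {α : GG m} (h : crt W α) : ¬ upp W α := by
  rintro ⟨_, v, h1, h2⟩
  rw [h.2] at h1; cases h1

theorem crt_not_low {W : Finset (II m N)} {α : GG m} (h : crt W α) : ¬ low W α := by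
  rintro ⟨_, v, h1, h2⟩
  rw [h.2] at h1; cases h1

theorem trich {W : Finset (II m N)} {α : GG m} (h : valid m N W α) :
    low W α ∨ upp W α ∨ crt W α := by
  cases hs : star W α with
  | none => exact Or.inr (Or.inr ⟨h, hs⟩)
  | some v =>
    by_cases hv : Sum.inl v ∈ W
    · exact Or.inl ⟨h, v, hs, hv⟩
    · exact Or.inr (Or.inl ⟨h, v, hs, hv⟩)

variable {S : Type} [CommRing S] 

open Classical in
variable (m N S) in
def hh : Module.End S (FF m N S) where
  toFun z W α := if h : low W α then
    sg (ord m N) S (Sum.inl h.2.choose) W * z (W.erase (Sum.inl h.2.choose)) α else 0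
  map_add' a b := by ext W α; simp only [Pi.add_apply]; split_ifs <;> simp [mul_add]
  map_smul' a b := by
    ext W α; simp only [Pi.smul_apply, RingHom.id_apply]; split_ifs <;> simp [mul_left_comm]

open Classical in
variable (m N S) in
def d0 : Module.End S (FF m N S) where
  toFun z W α := if h : upp W α then
    sg (ord m N) S (Sum.inl h.2.choose) W * z (insert (Sum.inl h.2.choose) W) α else 0
  map_add' a b := by ext W α; simp only [Pi.add_apply]; split_ifs <;> simp [mul_add]
  map_smul' a b := by
    ext W α; simp only [Pi.smul_apply, RingHom.id_apply]; split_ifs <;> simp [mul_left_comm]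

open Classical in
variable (m N S) in
def pr : Module.End S (FF m N S) where
  toFun z W α := if crt W α then z W α else 0
  map_add' a b := by ext W α; simp only [Pi.add_apply]; split_ifs <;> simp
  map_smul' a b := by
    ext W α; simp only [Pi.smul_apply, RingHom.id_apply]; split_ifs <;> simp

theorem hh_low (z : FF m N S) {W : Finset (II m N)} {α : GG m} (h : valid m N W α) {v : VV m}
    (hs : star W α = some v) (hv : Sum.inl v ∈ W) :
    hh m N S z W α = sg (ord m N) S (Sum.inl v) W * z (W.erase (Sum.inl v)) α := by
  have hl : low W α := ⟨h, v, hs, hv⟩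
  have e : hl.2.choose = v := by
    have := hl.2.choose_spec.1
    exact (Option.some.inj (hs.symm.trans this)).symm
  simp only [hh, LinearMap.coe_mk, AddHom.coe_mk, dif_pos hl, e]

theorem hh_zero (z : FF m N S) {W : Finset (II m N)} {α : GG m} (h : ¬ low W α) :
    hh m N S z W α = 0 := by
  simp only [hh, LinearMap.coe_mk, AddHom.coe_mk, dif_neg h]

theorem d0_upp (z : FF m N S) {W : Finset (II m N)} {α : GG m} (h : valid m N W α) {v : VV m}
    (hs : star W α = some v) (hv : Sum.inl v ∉ W) :
    d0 m N S z W α = sg (ord m N) S (Sum.inl v) W * z (insert (Sum.inl v) W) α := by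
  have hl : upp W α := ⟨h, v, hs, hv⟩
  have e : hl.2.choose = v := by
    have := hl.2.choose_spec.1
    exact (Option.some.inj (hs.symm.trans this)).symm
  simp only [d0, LinearMap.coe_mk, AddHom.coe_mk, dif_pos hl, e]

theorem d0_zero (z : FF m N S) {W : Finset (II m N)} {α : GG m} (h : ¬ upp W α) :
    d0 m N S z W α = 0 := by
  simp only [d0, LinearMap.coe_mk, AddHom.coe_mk, dif_neg h]

theorem pr_crt (z : FF m N S) {W : Finset (II m N)} {α : GG m} (h : crt W α) :
    pr m N S z W α = z W α := by
  simp only [pr, LinearMap.coe_mk, AddHom.coe_mk, if_pos h]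

theorem pr_zero (z : FF m N S) {W : Finset (II m N)} {α : GG m} (h : ¬ crt W α) :
    pr m N S z W α = 0 := by
  simp only [pr, LinearMap.coe_mk, AddHom.coe_mk, if_neg h]

/-- a lower cell comes from an upper one -/
theorem low_erase {W : Finset (II m N)} {α : GG m} (h : valid m N W α) {v : VV m}
    (hs : star W α = some v) (hv : Sum.inl v ∈ W) :
    valid m N (W.erase (Sum.inl v)) α ∧ star (W.erase (Sum.inl v)) α = some v := by
  rw [← insert_erase hv] at h hs
  exact ⟨valid_of_insert h, tog_star' (by simp) h hs⟩

theorem ext3 {A B : Module.End S (FF m N S)} (h : ∀ z W α, A z W α = B z W α) : A = B :=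
  LinearMap.ext fun z => funext fun W => funext fun α => h z W α

variable (x : Fin n → S)

variable (m N) in
def dP : Module.End S (FF m N S) := DD x * PP m N S

/-- number of Koszul indices -/
def jJ (W : Finset (II m N)) : ℕ := (univ.filter fun k : Fin N => Sum.inr k ∈ W).card

theorem jJ_inl (W : Finset (II m N)) (v : VV m) : jJ (insert (Sum.inl v) W) = jJ W := by
  simp [jJ]

theorem jJ_inl' (W : Finset (II m N)) (v : VV m) : jJ (W.erase (Sum.inl v)) = jJ W := by
  simp [jJ]

theorem jJ_inr (W : Finset (II m N)) (k : Fin N) (h : Sum.inr k ∉ W) :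
    jJ (insert (Sum.inr k) W) = jJ W + 1 := by
  unfold jJ
  have : (univ.filter fun l : Fin N => Sum.inr l ∈ insert (Sum.inr k) W) =
      insert k (univ.filter fun l : Fin N => Sum.inr l ∈ W) := by
    ext l; simp
  rw [this, card_insert_of_notMem]
  simpa using h

theorem jJ_le (W : Finset (II m N)) : jJ W ≤ N := by
  have := card_le_univ (univ.filter fun l : Fin N => (Sum.inr l : II m N) ∈ W)
  rwa [Fintype.card_fin] at this

def Lam (a : ℕ) (z : FF m N S) : Prop := ∀ W α, z W α ≠ 0 →
  low W α ∧ ∀ v, star W α = some v → jJ W * (n + 1) + v.1 < a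

def TT : Module.End S (FF m N S) := hh m N S * (dP m N x - d0 m N S)

theorem TT_low (z : FF m N S) : Lam ((N + 1) * (n + 1)) (TT x z) := by
  intro W α h
  by_cases hl : low W α
  · refine ⟨hl, fun v _ => ?_⟩
    have := jJ_le W
    have h2 := v.1.2
    have := Nat.mul_le_mul_right (n + 1) this
    have e : (N + 1) * (n + 1) = N * (n + 1) + (n + 1) := by ring
    omega
  · exact absurd (hh_zero _ hl) h

theorem TT_dec (a : ℕ) (z : FF m N S) (hz : Lam (a + 1) z) : Lam a (TT x z) := by
  intro W α h
  have hl : low W α := (TT_low x z W α h).1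
  refine ⟨hl, fun v hs => ?_⟩
  obtain ⟨hval, v', hs', hv⟩ := hl
  obtain rfl : v = v' := by rw [hs] at hs'; exact Option.some.inj hs'
  by_contra hc
  push Not at hc
  apply h
  obtain ⟨hval0, hs0⟩ := low_erase hval hs hv
  rw [TT, Module.End.mul_apply, hh_low _ hval hs hv]
  rw [← jJ_inl' W v] at hc
  have hn0 : Sum.inl v ∉ W.erase (Sum.inl v) := by simp
  generalize W.erase (Sum.inl v) = W0 at *
  have hPz : PP m N S z = z := by
    rw [PP_eq_iff]
    intro W α hn
    by_contra h
    exact hn (hz W α h).1.1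
  rw [LinearMap.sub_apply, Pi.sub_apply, Pi.sub_apply, dP, Module.End.mul_apply, hPz,
    d0_upp _ hval0 hs0 hn0, DD_apply]
  convert mul_zero _
  rw [sub_eq_zero]
  convert add_zero _
  · refine sum_eq_zero fun k _ => ?_
    split_ifs with hk
    · rfl
    convert mul_zero _
    refine sum_eq_zero fun i _ => sum_eq_zero fun u _ => ?_
    split_ifs
    · convert mul_zero _
      by_contra hne
      obtain ⟨⟨_, v'', h1, _⟩, h2⟩ := hz _ _ hne
      have := h2 _ h1
      rw [jJ_inr _ _ hk] at this
      have := v.1.2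
      have e : (jJ W0 + 1) * (n + 1) = jJ W0 * (n + 1) + (n + 1) := by ring
      omega
    · rfl
  · rw [Finset.sum_eq_single v]
    · rw [if_neg hn0]
    · intro v' _ hne
      split_ifs with hv'
      · rfl
      convert mul_zero _
      by_contra hne2
      obtain ⟨⟨hval2, v'', h1, hin⟩, h2⟩ := hz _ _ hne2
      have h3 := h2 _ h1
      rw [jJ_inl] at h3
      obtain ⟨hc1, hc2, hc3⟩ := star_some hs0
      obtain ⟨he1, he2, he3⟩ := star_some h1
      have hle : v''.1 ≤ v.1 := by
        rw [Fin.le_def]; omega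
      have hnv : Sum.inl v ∉ insert (Sum.inl v') W0 := by simp [hn0, hne.symm]
      rcases lt_or_ge v'.1 v.1 with hlt | hge
      · -- impossible by validity
        rcases hc2 _ hlt with h5 | ⟨h5, h6⟩
        · have := hval2.1 v' (mem_insert_self _ _)
          exact absurd this (not_le.2 (h5 v'.2))
        · obtain ⟨t, ht⟩ := hval2.2 v'.1
          by_cases e : t = v'.2
          · subst e; exact ht (mem_insert_self _ _)
          · have h7 : v'.2 = 0 := by
              by_contra h8
              exact hv' ((h6 v'.2).2 h8)
            exact ht (mem_insert_of_mem ((h6 t).2 (by rw [← h7]; exact e)))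
      · have hlt : ∀ i < v.1, critj (insert (Sum.inl v') W0) α i := fun i hi => by
          rw [critj_insert (ne_of_lt (lt_of_lt_of_le hi hge))]
          exact hc2 i hi
        have : v''.1 = v.1 := by
          rcases hle.lt_or_eq with h8 | h8
          · exact absurd (hlt _ h8) he1
          · exact h8
        rw [this, ← hc3] at he3
        rw [he3] at hin
        exact hnv hin
    · simp

theorem TT_nil : (TT x : Module.End S (FF m N S)) ^ ((N + 1) * (n + 1) + 1) = 0 := by
  refine LinearMap.ext fun z => ?_
  have key : ∀ b a (z : FF m N S), Lam (a + b) z →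
      Lam a (((TT x : Module.End S (FF m N S)) ^ b) z) := by
    intro b
    induction b with
    | zero => intro a z h; exact h
    | succ b ih =>
      intro a z h
      rw [pow_succ', Module.End.mul_apply]
      apply TT_dec
      apply ih
      convert h using 1; ring
  have h1 := key ((N + 1) * (n + 1)) 0 (TT x z) (by rw [zero_add]; exact TT_low x z)
  rw [← Module.End.mul_apply, ← pow_succ] at h1
  funext W α
  by_contra h
  obtain ⟨⟨_, v, hs, _⟩, h2⟩ := h1 W α h
  exact absurd (h2 v hs) (Nat.not_lt_zero _)

variable (m N) in
def YY : Module.End S (FF m N S) := ∑ i ∈ range ((N + 1) * (n + 1) + 1), (-TT x) ^ i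

variable (m N) in
def YY' : Module.End S (FF m N S) := 1 - (dP m N x - d0 m N S) * YY m N x * hh m N S

theorem YY_1 : (1 + TT x) * YY m N x = 1 := by
  have := mul_neg_geom_sum (-(TT x : Module.End S (FF m N S))) ((N + 1) * (n + 1) + 1)
  rw [neg_pow (TT x : Module.End S (FF m N S)) ((N + 1) * (n + 1) + 1), TT_nil, mul_zero, sub_neg_eq_add, sub_zero] at this
  exact this

theorem YY_2 : YY m N x * (1 + TT x) = 1 := by
  have := geom_sum_mul_neg (-(TT x : Module.End S (FF m N S))) ((N + 1) * (n + 1) + 1)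
  rw [neg_pow (TT x : Module.End S (FF m N S)) ((N + 1) * (n + 1) + 1), TT_nil, mul_zero, sub_neg_eq_add, sub_zero] at this
  exact this

theorem geo1 {E : Type*} [Ring E] (δ g Y : E) (h : (1 + g * δ) * Y = 1) :
    (1 + δ * g) * (1 - δ * Y * g) = 1 := by
  calc (1 + δ * g) * (1 - δ * Y * g) = 1 + δ * g - δ * ((1 + g * δ) * Y) * g := by noncomm_ring
    _ = 1 := by rw [h]; noncomm_ring

theorem geo2 {E : Type*} [Ring E] (δ g Y : E) (h : Y * (1 + g * δ) = 1) :
    (1 - δ * Y * g) * (1 + δ * g) = 1 := by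
  calc (1 - δ * Y * g) * (1 + δ * g) = 1 + δ * g - δ * (Y * (1 + g * δ)) * g := by noncomm_ring
    _ = 1 := by rw [h]; noncomm_ring

theorem pert : Pert (PP m N S) (dP m N x) (d0 m N S) (hh m N S) (pr m N S) (YY m N x)
    (YY' m N x) where
  dd := by
    rw [dP, mul_assoc, PDP, ← mul_assoc, DD_sq, zero_mul]
  d0d0 := by
    refine ext3 fun z W α => ?_
    rw [Module.End.mul_apply]
    by_cases h : upp W α
    · obtain ⟨h1, v, h2, h3⟩ := h
      rw [d0_upp _ h1 h2 h3, d0_zero, mul_zero]; · rfl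
      exact low_not_upp ⟨tog_valid h3 h1 h2, v, tog_star h3 h1 h2, mem_insert_self _ _⟩
    · rw [d0_zero _ h]; rfl
  hh := by
    refine ext3 fun z W α => ?_
    rw [Module.End.mul_apply]
    by_cases h : low W α
    · obtain ⟨h1, v, h2, h3⟩ := h
      have h4 := low_erase h1 h2 h3
      rw [hh_low _ h1 h2 h3, hh_zero, mul_zero]; · rfl
      exact fun h => low_not_upp h ⟨h4.1, v, h4.2, by simp⟩
    · rw [hh_zero _ h]; rfl
  Pd := PDP m N x
  dP := by rw [dP, mul_assoc, PP_sq]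
  Pd0 := by
    refine LinearMap.ext fun z => ?_
    rw [Module.End.mul_apply, PP_eq_iff]
    intro W α h
    exact d0_zero _ fun h' => h h'.1
  d0P := by
    classical
    refine ext3 fun z W α => ?_
    rw [Module.End.mul_apply]
    by_cases h : upp W α
    · obtain ⟨h1, v, h2, h3⟩ := h
      rw [d0_upp _ h1 h2 h3, d0_upp _ h1 h2 h3, PP_apply, if_pos (tog_valid h3 h1 h2)]
    · rw [d0_zero _ h, d0_zero _ h]
  pp := by
    refine ext3 fun z W α => ?_
    rw [Module.End.mul_apply]
    by_cases h : crt W α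
    · rw [pr_crt _ h]
    · rw [pr_zero _ h, pr_zero _ h]
  hp := by
    refine ext3 fun z W α => ?_
    rw [Module.End.mul_apply]
    by_cases h : low W α
    · obtain ⟨h1, v, h2, h3⟩ := h
      have h4 := low_erase h1 h2 h3
      rw [hh_low _ h1 h2 h3, pr_zero, mul_zero]; · rfl
      exact fun h => crt_not_upp h ⟨h4.1, v, h4.2, by simp⟩
    · rw [hh_zero _ h]; rfl
  ph := by
    refine ext3 fun z W α => ?_
    rw [Module.End.mul_apply]
    by_cases h : crt W α
    · rw [pr_crt _ h, hh_zero _ (crt_not_low h)]; rfl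
    · rw [pr_zero _ h]; rfl
  d0p := by
    refine ext3 fun z W α => ?_
    rw [Module.End.mul_apply]
    by_cases h : upp W α
    · obtain ⟨h1, v, h2, h3⟩ := h
      rw [d0_upp _ h1 h2 h3, pr_zero, mul_zero]; · rfl
      exact fun h => crt_not_low h
        ⟨tog_valid h3 h1 h2, v, tog_star h3 h1 h2, mem_insert_self _ _⟩
    · rw [d0_zero _ h]; rfl
  pd0 := by
    refine ext3 fun z W α => ?_
    rw [Module.End.mul_apply]
    by_cases h : crt W α
    · rw [pr_crt _ h, d0_zero _ (crt_not_upp h)]; rfl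
    · rw [pr_zero _ h]; rfl
  hom := by
    classical
    refine ext3 fun z W α => ?_
    simp only [LinearMap.sub_apply, Pi.sub_apply, Module.End.mul_apply]
    by_cases hv : valid m N W α
    swap
    · rw [pr_zero _ (fun h => hv h.1), PP_apply, if_neg hv, d0_zero _ (fun h => hv h.1),
        hh_zero _ (fun h => hv h.1)]
      simp
    rw [PP_apply, if_pos hv]
    rcases trich hv with h | h | h
    · rw [d0_zero _ (low_not_upp h), pr_zero _ (fun h' => crt_not_low h' h)]
      obtain ⟨h1, v, h2, h3⟩ := h
      have h4 := low_erase h1 h2 h3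
      rw [hh_low _ h1 h2 h3, d0_upp _ h4.1 h4.2 (by simp), insert_erase h3, sg_erase_self,
        sg_mul_mul_self]
      simp
    · rw [hh_zero _ (fun h' => low_not_upp h' h), pr_zero _ (fun h' => crt_not_upp h' h)]
      obtain ⟨h1, v, h2, h3⟩ := h
      rw [d0_upp _ h1 h2 h3, hh_low _ (tog_valid h3 h1 h2) (tog_star h3 h1 h2)
        (mem_insert_self _ _), erase_insert h3, sg_insert_self, sg_mul_mul_self]
      simp
    · rw [pr_crt _ h, d0_zero _ (crt_not_upp h), hh_zero _ (crt_not_low h)]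
      simp
  Y1 := YY_1 x
  Y2 := YY_2 x
  Y'1 := by
    have h := YY_1 (m := m) (N := N) x
    rw [TT] at h
    rw [YY']
    exact geo1 _ _ _ h
  Y'2 := by
    have h := YY_2 (m := m) (N := N) x
    rw [TT] at h
    rw [YY']
    exact geo2 _ _ _ h

variable (m N) in
/-- the Morse differential -/
def dF : Module.End S (FF m N S) :=
  pr m N S * (dP m N x - d0 m N S) * YY m N x * pr m N S

theorem dF_sq : dF m N x * dF m N x = 0 := (pert x).sq

theorem pr_dF (z) : pr m N S (dF m N x z) = dF m N x z := by
  rw [← Module.End.mul_apply, dF, mul_assoc, mul_assoc, ← mul_assoc (pr m N S), (pert x).pp]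

theorem dF_pr (z) : dF m N x (pr m N S z) = dF m N x z := by
  rw [← Module.End.mul_apply, dF, mul_assoc _ (pr m N S), (pert x).pp]

theorem pr_pr (z) : pr m N S (pr m N S z) = pr m N S z := by
  rw [← Module.End.mul_apply, (pert (0 : Fin n → S)).pp]

theorem dF_torsion [IsNoetherianRing S] (hN : n + ∑ j, m j ≤ N) (i : Fin n) :
    ∃ M : ℕ, ∀ z : FF m N S, pr m N S z = z → dF m N x z = 0 →
      ∃ w, x i ^ M • z = dF m N x w := by
  obtain ⟨M, hM⟩ := torsion m N x hN i
  refine ⟨M, fun z h1 h2 => ?_⟩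
  have H := pert (m := m) (N := N) x
  have PY : PP m N S * (YY m N x * pr m N S) = YY m N x * pr m N S := by
    have a1 : YY m N x = 1 - hh m N S * (dP m N x - d0 m N S) * YY m N x := by
      have := H.Y1; rw [add_mul, one_mul] at this; rw [← this]; abel
    have a2 : PP m N S * hh m N S = hh m N S := by
      refine LinearMap.ext fun z => ?_
      rw [Module.End.mul_apply, PP_eq_iff]
      exact fun W α h => hh_zero _ fun h' => h h'.1
    have a3 : PP m N S * pr m N S = pr m N S := by
      refine LinearMap.ext fun z => ?_
      rw [Module.End.mul_apply, PP_eq_iff]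
      exact fun W α h => pr_zero _ fun h' => h h'.1
    rw [a1, sub_mul, one_mul, mul_sub, a3]
    congr 1
    simp only [← mul_assoc]
    rw [a2]
  have Pz : PP m N S (YY m N x z) = YY m N x z := by
    have := LinearMap.congr_fun PY z
    simpa only [Module.End.mul_apply, h1] using this
  have Dz : DD x (YY m N x z) = 0 := by
    have := LinearMap.congr_fun H.incl z
    simp only [Module.End.mul_apply, h1] at this
    have h3 : pr m N S ((dP m N x - d0 m N S) (YY m N x z)) = 0 := by
      rw [← h2, dF]
      simp only [Module.End.mul_apply, h1]
    rw [h3] at this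
    simp only [map_zero] at this
    rw [dP, Module.End.mul_apply, Pz] at this
    exact this
  obtain ⟨w, hw⟩ := hM _ Pz Dz
  refine ⟨pr m N S (YY' m N x w), ?_⟩
  have e1 := LinearMap.congr_fun H.proj w
  have e2 := LinearMap.congr_fun H.retract z
  simp only [Module.End.mul_apply, h1] at e2
  have e3 : (pr m N S * YY' m N x) (dP m N x w) = dF m N x (pr m N S (YY' m N x w)) := e1
  have e4 : dP m N x w = x i ^ M • YY m N x z := hw.symm
  rw [← e3, e4, Module.End.mul_apply, map_smul, map_smul, e2]

/-- the Morse differential and gradings -/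
theorem dF_graded (Q : ℤ → Finset (II m N) → GG m → AddSubgroup S)
    (h1 : ∀ s W v α, Sum.inl v ∉ W → Q s (insert (Sum.inl v) W) α = Q (s - 1) W α)
    (h2 : ∀ s W k α u i, Sum.inr k ∉ W → ∀ a ∈ Q s (insert (Sum.inr k) W) (α - yexp m u),
      x i * a ∈ Q (s - 1) W α)
    (s : ℤ) (z : FF m N S) (hz : ∀ W α, z W α ∈ Q s W α) (W : Finset (II m N)) (α : GG m) :
    dF m N x z W α ∈ Q (s - 1) W α := by
  classical
  have hsg : ∀ s w W α, ∀ a ∈ Q s W α, sg (ord m N) S w W * a ∈ Q s W α := by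
    intro s w W α a ha
    rcases neg_one_pow_eq_or S (W.filter (fun u => ord m N u < ord m N w)).card with h | h
    · rw [sg, h, one_mul]; exact ha
    · rw [sg, h, neg_one_mul]; exact neg_mem ha
  have gpr : ∀ s (z : FF m N S), (∀ W α, z W α ∈ Q s W α) →
      ∀ W α, pr m N S z W α ∈ Q s W α := by
    intro s z hz W α
    by_cases h : crt W α
    · rw [pr_crt _ h]; exact hz _ _
    · rw [pr_zero _ h]; exact zero_mem _
  have gP : ∀ s (z : FF m N S), (∀ W α, z W α ∈ Q s W α) →
      ∀ W α, PP m N S z W α ∈ Q s W α := by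
    intro s z hz W α
    rw [PP_apply]
    split_ifs
    · exact hz _ _
    · exact zero_mem _
  have gd0 : ∀ s (z : FF m N S), (∀ W α, z W α ∈ Q s W α) →
      ∀ W α, d0 m N S z W α ∈ Q (s - 1) W α := by
    intro s z hz W α
    by_cases h : upp W α
    · obtain ⟨a1, v, a2, a3⟩ := h
      rw [d0_upp _ a1 a2 a3]
      apply hsg
      rw [← h1 _ _ _ _ a3]
      exact hz _ _
    · rw [d0_zero _ h]; exact zero_mem _
  have gh : ∀ s (z : FF m N S), (∀ W α, z W α ∈ Q s W α) →
      ∀ W α, hh m N S z W α ∈ Q (s + 1) W α := by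
    intro s z hz W α
    by_cases h : low W α
    · obtain ⟨a1, v, a2, a3⟩ := h
      rw [hh_low _ a1 a2 a3]
      apply hsg
      have := h1 (s + 1) (W.erase (Sum.inl v)) v α (by simp)
      rw [insert_erase a3] at this
      rw [this, add_sub_cancel_right]
      exact hz _ _
    · rw [hh_zero _ h]; exact zero_mem _
  have gδ : ∀ s (z : FF m N S), (∀ W α, z W α ∈ Q s W α) →
      ∀ W α, (dP m N x - d0 m N S) z W α ∈ Q (s - 1) W α := by
    intro s z hz W α
    rw [LinearMap.sub_apply]
    refine sub_mem ?_ (gd0 s z hz W α)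
    rw [dP, Module.End.mul_apply]
    exact DD_graded m N x (Q s) (Q (s - 1)) (fun W v α h => (h1 s W v α h).le) (h2 s) _
      (gP s z hz) W α
  have gT : ∀ s (z : FF m N S), (∀ W α, z W α ∈ Q s W α) →
      ∀ W α, TT x z W α ∈ Q s W α := by
    intro s z hz W α
    rw [TT, Module.End.mul_apply]
    have := gh (s - 1) _ (gδ s z hz) W α
    rwa [sub_add_cancel] at this
  have gTi : ∀ i s (z : FF m N S), (∀ W α, z W α ∈ Q s W α) →
      ∀ W α, ((-TT x) ^ i) z W α ∈ Q s W α := by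
    intro i
    induction i with
    | zero => intro s z hz W α; exact hz W α
    | succ i ih =>
      intro s z hz W α
      rw [pow_succ', Module.End.mul_apply, LinearMap.neg_apply]
      exact neg_mem (gT _ _ (ih _ _ hz) W α)
  have gY : ∀ s (z : FF m N S), (∀ W α, z W α ∈ Q s W α) →
      ∀ W α, YY m N x z W α ∈ Q s W α := by
    intro s z hz W α
    rw [YY, LinearMap.sum_apply, Finset.sum_apply, Finset.sum_apply]
    exact sum_mem fun i _ => gTi i s z hz W α
  rw [dF]
  simp only [Module.End.mul_apply]
  exact gpr _ _ (gδ _ _ (gY _ _ (gpr _ _ hz))) W α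

end Matching
end PR

namespace PR
set_option linter.unusedSectionVars false
set_option linter.style.haveILetI false

/-! ### Combinatorics of critical cells -/

section Comb
variable {n : ℕ} (m : Fin n → ℕ)

def dS (a : ℕ) : ℕ := ∑ j : Fin n, if j.1 < a then m j + 1 else 0

abbrev NN : ℕ := n + ∑ j, m j

theorem dS_zero : dS m 0 = 0 := by simp [dS]

theorem dS_mono {a b : ℕ} (h : a ≤ b) : dS m a ≤ dS m b := by
  refine sum_le_sum fun j _ => ?_
  split_ifs <;> omega

theorem dS_succ (j : Fin n) : dS m (j.1 + 1) = dS m j.1 + (m j + 1) := by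
  have : ∀ i : Fin n, (if i.1 < j.1 + 1 then m i + 1 else 0) =
      (if i.1 < j.1 then m i + 1 else 0) + if i = j then m i + 1 else 0 := by
    intro i
    have : i = j ↔ i.1 = j.1 := Fin.ext_iff
    simp only [this]
    split_ifs <;> omega
  simp only [dS, this, sum_add_distrib]
  simp

theorem dS_n : dS m n = NN m := by
  simp [dS, NN, sum_add_distrib, add_comm]

theorem dS_eq {a b : ℕ} (ha : a ≤ n) (hb : b ≤ n) (h : dS m a = dS m b) : a = b := by
  by_contra hne
  rcases lt_or_gt_of_ne hne with h1 | h1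
  · have := dS_succ m ⟨a, by omega⟩
    have := dS_mono m (show a + 1 ≤ b by omega)
    simp only at *
    omega
  · have := dS_succ m ⟨b, by omega⟩
    have := dS_mono m (show b + 1 ≤ a by omega)
    simp only at *
    omega

/-- internal multidegree -/
def wt (W : Finset (II m (NN m))) (α : GG m) (j : Fin n) : ℤ := ∑ t, α ⟨j, t⟩ + jJ W

theorem card_W {N : ℕ} (W : Finset (II m N)) :
    W.card = jJ W + ∑ j, (univ.filter fun t : Fin (m j + 1) => Sum.inl ⟨j, t⟩ ∈ W).card := by
  classical
  have : W.card = ∑ w : II m N, if w ∈ W then 1 else 0 := by simp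
  rw [this, Fintype.sum_sum_type, add_comm, Fintype.sum_sigma]
  simp only [jJ, card_filter]

theorem crit_struct {W : Finset (II m (NN m))} {α : GG m} (hc : crt W α)
    (hw : ∀ j, wt m W α j = dS m j.1) : ∃ a ≤ n, W.card = a + ∑ j, m j ∧ jJ W = dS m a ∧
      ∀ j : Fin n, (j.1 < a → ∀ t, α ⟨j, t⟩ < 0 ∧ Sum.inl ⟨j, t⟩ ∉ W) ∧
        (a ≤ j.1 → ∀ t, 0 ≤ α ⟨j, t⟩ ∧ (Sum.inl ⟨j, t⟩ ∈ W ↔ t ≠ 0)) := by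
  classical
  obtain ⟨hv, hs⟩ := hc
  rw [star_none_iff] at hs
  set k := jJ W with hk
  let a := Nat.findGreatest (fun a => dS m a ≤ k) n
  have ha : a ≤ n := Nat.findGreatest_le n
  have hak : dS m a ≤ k := Nat.findGreatest_spec (P := fun a => dS m a ≤ k) (Nat.zero_le n)
    (by rw [dS_zero]; omega)
  have hneg : ∀ j : Fin n, (∀ t, α ⟨j, t⟩ < 0) → j.1 < a := by
    intro j h
    have h1 := hw j
    have h2 : ∑ t, α ⟨j, t⟩ ≤ ∑ t : Fin (m j + 1), (-1 : ℤ) :=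
      sum_le_sum fun t _ => by have := h t; omega
    simp only [sum_const, card_univ, Fintype.card_fin, smul_eq_mul, nsmul_eq_mul] at h2
    push_cast at h2
    have h3 := dS_succ m j
    refine Nat.le_findGreatest (P := fun a => dS m a ≤ k) j.2 ?_
    simp only [wt] at h1
    zify
    zify at h3
    rw [← hk] at h1
    linarith
  have hpos : ∀ j : Fin n, (∀ t, 0 ≤ α ⟨j, t⟩) → k ≤ dS m j.1 := by
    intro j h
    have h1 := hw j
    have h2 : 0 ≤ ∑ t, α ⟨j, t⟩ := sum_nonneg fun t _ => h t
    simp only [wt] at h1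
    zify
    rw [← hk] at h1
    linarith
  have hlt : ∀ j : Fin n, j.1 < a → ∀ t, α ⟨j, t⟩ < 0 := by
    intro j hj
    rcases hs j with h | ⟨h, _⟩
    · exact h
    · exfalso
      have h1 := hpos j h
      have h2 := dS_mono m (show j.1 + 1 ≤ a from hj)
      have h3 := dS_succ m j
      omega
  have hge : ∀ j : Fin n, a ≤ j.1 → (∀ t, 0 ≤ α ⟨j, t⟩) ∧ ∀ t, Sum.inl ⟨j, t⟩ ∈ W ↔ t ≠ 0 := by
    intro j hj
    rcases hs j with h | h
    · have := hneg j h; omega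
    · exact h
  have hka : k = dS m a := by
    apply le_antisymm _ hak
    rcases ha.lt_or_eq with h | h
    · exact hpos ⟨a, h⟩ (hge ⟨a, h⟩ le_rfl).1
    · rw [h, dS_n]; exact jJ_le W
  have hnot : ∀ j : Fin n, j.1 < a → ∀ t, Sum.inl ⟨j, t⟩ ∉ W := by
    intro j hj t ht
    have := hv.1 _ ht
    have := hlt j hj t
    omega
  refine ⟨a, ha, ?_, hka, fun j => ⟨fun h t => ⟨hlt j h t, hnot j h t⟩,
    fun h t => ⟨(hge j h).1 t, (hge j h).2 t⟩⟩⟩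
  have hcard : ∀ j : Fin n, (univ.filter fun t : Fin (m j + 1) => Sum.inl ⟨j, t⟩ ∈ W).card =
      if j.1 < a then 0 else m j := by
    intro j
    split_ifs with h
    · rw [card_eq_zero, filter_eq_empty_iff]
      exact fun t _ => hnot j h t
    · have : (univ.filter fun t : Fin (m j + 1) => Sum.inl ⟨j, t⟩ ∈ W) = univ.erase 0 := by
        ext t
        simp [(hge j (not_lt.1 h)).2 t]
      rw [this, card_erase_of_mem (mem_univ _)]
      simp
  have e1 : ∀ j : Fin n, (if j.1 < a then m j + 1 else 0) + (if j.1 < a then 0 else m j) =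
      m j + if j.1 < a then 1 else 0 := by
    intro j
    split_ifs <;> omega
  rw [card_W, ← hk, hka, dS]
  simp only [hcard]
  rw [← sum_add_distrib]
  simp only [e1]
  rw [sum_add_distrib, ← card_filter, Fin.card_filter_val_lt, add_comm, min_eq_right ha]

/-- critical cells in homological degree `i` -/
def cset (i : ℕ) : Set (Finset (II m (NN m)) × GG m) :=
  {c | crt c.1 c.2 ∧ c.1.card = i + ∑ j, m j ∧ ∀ j, wt m c.1 c.2 j = dS m j.1}

theorem cset_struct {i : ℕ} {c} (hc : c ∈ cset m i) : i ≤ n ∧ jJ c.1 = dS m i ∧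
      ∀ j : Fin n, (j.1 < i → ∀ t, c.2 ⟨j, t⟩ < 0 ∧ Sum.inl ⟨j, t⟩ ∉ c.1) ∧
        (i ≤ j.1 → ∀ t, 0 ≤ c.2 ⟨j, t⟩ ∧ (Sum.inl ⟨j, t⟩ ∈ c.1 ↔ t ≠ 0)) := by
  obtain ⟨h1, h2, h3⟩ := hc
  obtain ⟨a, h4, h5, h6, h7⟩ := crit_struct m h1 h3
  obtain rfl : i = a := by omega
  exact ⟨h4, h6, h7⟩

theorem cset_finite (i : ℕ) : (cset m i).Finite := by
  have h1 : ((Set.univ : Set (Finset (II m (NN m)))) ×ˢ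
      Set.Icc (fun _ => -(NN m : ℤ)) (fun _ => (NN m : ℤ) : GG m)).Finite :=
    Set.finite_univ.prod (Set.finite_Icc _ _)
  refine h1.subset ?_
  rintro ⟨W, α⟩ hc
  obtain ⟨hi, hJ, hs⟩ := cset_struct m hc
  obtain ⟨_, _, hw⟩ := hc
  simp only at *
  have key : ∀ j t, -(NN m : ℤ) ≤ α ⟨j, t⟩ ∧ α ⟨j, t⟩ ≤ NN m := by
    intro j t
    have h2 := hw j
    simp only [wt] at h2
    have h3 := jJ_le W
    have h4 := dS_mono m j.2.le
    rw [dS_n] at h4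
    rcases lt_or_ge j.1 i with h | h
    · have h5 := (hs j).1 h
      have : ∑ s, α ⟨j, s⟩ ≤ α ⟨j, t⟩ := by
        rw [← Finset.add_sum_erase _ _ (mem_univ t)]
        have : ∑ s ∈ univ.erase t, α ⟨j, s⟩ ≤ 0 := sum_nonpos fun s _ => (h5 s).1.le
        linarith
      have := (h5 t).1
      constructor <;> omega
    · have h5 := (hs j).2 h
      have : α ⟨j, t⟩ ≤ ∑ s, α ⟨j, s⟩ :=
        Finset.single_le_sum (f := fun s => α ⟨j, s⟩) (fun s _ => (h5 s).1) (mem_univ t)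
      have := (h5 t).1
      constructor <;> omega
  exact ⟨trivial, fun v => (key v.1 v.2).1, fun v => (key v.1 v.2).2⟩

theorem cset_nonempty (i : ℕ) (hi : i ≤ n) : (cset m i).Nonempty := by
  classical
  obtain ⟨J, _, hJ⟩ := Finset.exists_subset_card_eq
    (show dS m i ≤ (univ : Finset (Fin (NN m))).card by
      rw [card_fin, ← dS_n]; exact dS_mono m hi)
  let W : Finset (II m (NN m)) := univ.filter fun w => match w with
    | Sum.inl v => i ≤ v.1.1 ∧ v.2 ≠ 0
    | Sum.inr k => k ∈ J
  let α : GG m := fun v => if i ≤ v.1.1 then (if v.2 = 0 then (dS m v.1.1 : ℤ) - dS m i else 0)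
    else (if v.2 = 0 then (dS m v.1.1 : ℤ) - dS m i + m v.1 else -1)
  have hl : ∀ v, Sum.inl v ∈ W ↔ i ≤ v.1.1 ∧ v.2 ≠ 0 := fun v => by simp [W]
  have hJW : jJ W = dS m i := by
    rw [← hJ, jJ]
    congr 1
    ext k; simp [W]
  have hge : ∀ j : Fin n, i ≤ j.1 → ∀ t, 0 ≤ α ⟨j, t⟩ := by
    intro j hj t
    have := dS_mono m hj
    simp only [α, if_pos hj]
    split_ifs <;> omega
  have hlt : ∀ j : Fin n, ¬ i ≤ j.1 → ∀ t, α ⟨j, t⟩ < 0 := by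
    intro j hj t
    have := dS_mono m (show j.1 + 1 ≤ i by omega)
    have := dS_succ m j
    simp only [α, if_neg hj]
    split_ifs <;> omega
  have hcrt : crt W α := by
    refine ⟨⟨?_, ?_⟩, ?_⟩
    · intro v hv
      exact hge v.1 ((hl v).1 hv).1 v.2
    · intro j
      exact ⟨0, fun h => ((hl _).1 h).2 rfl⟩
    · rw [star_none_iff]
      intro j
      by_cases h : i ≤ j.1
      · exact Or.inr ⟨hge j h, fun t => by rw [hl]; simp [h]⟩
      · exact Or.inl (hlt j h)
  have hwt : ∀ j, wt m W α j = dS m j.1 := by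
    intro j
    rw [wt, hJW, ← Finset.add_sum_erase _ _ (mem_univ (0 : Fin (m j + 1)))]
    by_cases h : i ≤ j.1
    · have : ∑ t ∈ univ.erase (0 : Fin (m j + 1)), α ⟨j, t⟩ = 0 := by
        refine sum_eq_zero fun t ht => ?_
        simp only [α, if_pos h, if_neg (ne_of_mem_erase ht)]
      rw [this]
      simp only [α, if_pos h, if_true]
      ring
    · have : ∑ t ∈ univ.erase (0 : Fin (m j + 1)), α ⟨j, t⟩ =
          ∑ t ∈ univ.erase (0 : Fin (m j + 1)), (-1 : ℤ) := by
        refine sum_congr rfl fun t ht => ?_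
        simp only [α, if_neg h, if_neg (ne_of_mem_erase ht)]
      rw [this]
      simp only [α, if_neg h, if_true, sum_const, card_erase_of_mem (mem_univ _), card_fin]
      simp
  obtain ⟨a, h4, h5, h6, h7⟩ := crit_struct m hcrt hwt
  rw [hJW] at h6
  obtain rfl := dS_eq m hi h4 h6
  exact ⟨(W, α), hcrt, h5, hwt⟩

theorem cset_card_zero : Nat.card (cset m 0) = ∏ j, (dS m j.1 + m j).choose (m j) := by
  classical
  let W0 : Finset (II m (NN m)) := univ.filter fun w => match w with
    | Sum.inl v => v.2 ≠ 0
    | Sum.inr k => False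
  have hl : ∀ v, Sum.inl v ∈ W0 ↔ v.2 ≠ 0 := fun v => by simp [W0]
  have hr : ∀ k, Sum.inr k ∉ W0 := fun v => by simp [W0]
  have hJ0 : jJ W0 = 0 := by
    rw [jJ, card_eq_zero, filter_eq_empty_iff]
    exact fun k _ => hr k
  let A : Finset (∀ j, Fin (m j + 1) →₀ ℕ) :=
    Fintype.piFinset fun j => finsuppAntidiag univ (dS m j.1)
  let φ : (∀ j, Fin (m j + 1) →₀ ℕ) → Finset (II m (NN m)) × GG m :=
    fun b => (W0, fun v => (b v.1 v.2 : ℤ))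
  have hφ : Function.Injective φ := by
    intro b c h
    simp only [φ, Prod.mk.injEq, true_and] at h
    funext j
    ext t
    have := congrFun h ⟨j, t⟩
    simpa using this
  have himg : cset m 0 = φ '' (A : Set _) := by
    ext ⟨W, α⟩
    constructor
    · intro hc
      obtain ⟨_, hJ, hs⟩ := cset_struct m hc
      obtain ⟨_, _, hw⟩ := hc
      simp only at hJ hs hw
      rw [dS_zero] at hJ
      have hs' := fun j => (hs j).2 (Nat.zero_le _)
      refine ⟨fun j => Finsupp.equivFunOnFinite.symm fun t => (α ⟨j, t⟩).toNat, ?_, ?_⟩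
      · simp only [A, mem_coe, Fintype.mem_piFinset, mem_finsuppAntidiag]
        intro j
        refine ⟨?_, by simp⟩
        have h1 := hw j
        rw [wt, hJ] at h1
        simp only [Finsupp.equivFunOnFinite_symm_apply_apply]
        zify
        rw [sum_congr rfl fun t _ => Int.toNat_of_nonneg (hs' j t).1]
        simpa using h1
      · simp only [φ, Prod.mk.injEq]
        constructor
        · ext w
          rcases w with ⟨j, t⟩ | k
          · rw [hl, (hs' j t).2]
          · simp only [hr, false_iff]
            rw [jJ, card_eq_zero, filter_eq_empty_iff] at hJ
            exact hJ (mem_univ k)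
        · funext ⟨j, t⟩
          simp [(hs' j t).1]
    · rintro ⟨b, hb, h⟩
      rw [← h]
      simp only [A, mem_coe, Fintype.mem_piFinset, mem_finsuppAntidiag] at hb
      have hwt : ∀ j, wt m W0 (fun v => (b v.1 v.2 : ℤ)) j = dS m j.1 := by
        intro j
        rw [wt, hJ0, ← (hb j).1]
        simp
      have hcrt : crt W0 (fun v => (b v.1 v.2 : ℤ)) := by
        refine ⟨⟨fun v _ => by simp, fun j => ⟨0, fun h => (hl _).1 h rfl⟩⟩, ?_⟩
        rw [star_none_iff]
        exact fun j => Or.inr ⟨fun t => by simp, fun t => by rw [hl]⟩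
      obtain ⟨a, h4, h5, h6, h7⟩ := crit_struct m hcrt hwt
      rw [hJ0, ← dS_zero m] at h6
      obtain rfl := dS_eq m (Nat.zero_le n) h4 h6
      exact ⟨hcrt, h5, hwt⟩
  rw [Nat.card_coe_set_eq, himg, Set.ncard_image_of_injective _ hφ, Set.ncard_coe_finset]
  simp only [A, Fintype.card_piFinset]
  refine prod_congr rfl fun j _ => ?_
  rw [card_finsuppAntidiag_nat_eq_choose, card_fin, ← Nat.choose_symm_add]
  congr 1
  omega

end Comb
end PR

namespace PR
set_option linter.unusedSectionVars false
set_option linter.style.haveILetI false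

/-! ### The strand complex -/

section Strand
variable {n : ℕ} (m : Fin n → ℕ) {S : Type} [CommRing S] (x : Fin n → S)

def rk (i : ℕ) : ℕ := Nat.card (cset m i)

def cell (i : ℕ) : Fin (rk m i) ≃ cset m i :=
  haveI : Finite (cset m i) := (cset_finite m i)
  (Finite.equivFin (cset m i)).symm

variable (S) in
open Classical in
def ex (i : ℕ) : (Fin (rk m i) → S) →ₗ[S] FF m (NN m) S where
  toFun f W α := if h : (W, α) ∈ cset m i then f ((cell m i).symm ⟨(W, α), h⟩) else 0
  map_add' f g := by
    funext W α
    simp only [Pi.add_apply]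
    split_ifs <;> simp
  map_smul' c f := by
    funext W α
    simp only [Pi.smul_apply, RingHom.id_apply]
    split_ifs <;> simp

variable (S) in
def re (i : ℕ) : FF m (NN m) S →ₗ[S] (Fin (rk m i) → S) where
  toFun z p := z (cell m i p).1.1 (cell m i p).1.2
  map_add' _ _ := rfl
  map_smul' _ _ := rfl

theorem re_apply (i : ℕ) (z : FF m (NN m) S) (p) :
    re m S i z p = z (cell m i p).1.1 (cell m i p).1.2 := rfl

theorem ex_mem {i : ℕ} (f) {W α} (h : (W, α) ∈ cset m i) :
    ex m S i f W α = f ((cell m i).symm ⟨(W, α), h⟩) := by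
  simp [ex, h]

theorem ex_not {i : ℕ} (f) {W α} (h : (W, α) ∉ cset m i) : ex m S i f W α = 0 := by
  simp [ex, h]

theorem re_ex (i : ℕ) (f) : re m S i (ex m S i f) = f := by
  funext p
  rw [re_apply, ex_mem m f (cell m i p).2]
  simp

theorem ex_re_mem {i : ℕ} (z) {W α} (h : (W, α) ∈ cset m i) :
    ex m S i (re m S i z) W α = z W α := by
  rw [ex_mem m _ h, re_apply]
  simp

theorem ex_re {i : ℕ} (z) (h : ∀ W α, (W, α) ∉ cset m i → z W α = 0) :
    ex m S i (re m S i z) = z := by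
  funext W α
  by_cases hc : (W, α) ∈ cset m i
  · exact ex_re_mem m z hc
  · rw [ex_not m _ hc, h W α hc]

theorem pr_ex (i : ℕ) (f) : pr m (NN m) S (ex m S i f) = ex m S i f := by
  funext W α
  by_cases hc : crt W α
  · rw [pr_crt _ hc]
  · rw [pr_zero _ hc, ex_not]
    exact fun h => hc h.1

theorem sum_yexp (u : ∀ j, Fin (m j + 1)) (j : Fin n) : ∑ t, yexp m u ⟨j, t⟩ = 1 := by
  classical
  have : ∀ t, yexp m u ⟨j, t⟩ = if u j = t then 1 else 0 := by
    intro t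
    simp only [yexp, Finset.sum_apply, Pi.single_apply]
    rw [Finset.sum_eq_single j]
    · simp [eq_comm]
    · intro b _ hb
      rw [if_neg]
      intro h
      exact hb (congrArg Sigma.fst h).symm
    · simp
  simp [this]

theorem wt_inl (W : Finset (II m (NN m))) (v α) : wt m (insert (Sum.inl v) W) α = wt m W α := by
  funext j
  simp [wt, jJ_inl]

theorem wt_inr (W : Finset (II m (NN m))) (k α u) (h : Sum.inr k ∉ W) :
    wt m (insert (Sum.inr k) W) (α - yexp m u) = wt m W α := by
  funext j
  simp only [wt, jJ_inr W k h, Pi.sub_apply, sum_sub_distrib, sum_yexp]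
  push_cast
  ring

theorem dF_supp (E : ℤ → (Fin n → ℤ) → Prop) (s : ℤ) (z : FF m (NN m) S)
    (hz : ∀ W α, ¬ E (W.card - s) (wt m W α) → z W α = 0) (W α)
    (h : ¬ E (W.card - (s - 1)) (wt m W α)) : dF m (NN m) x z W α = 0 := by
  classical
  let Q : ℤ → Finset (II m (NN m)) → GG m → AddSubgroup S := fun s W α =>
    if E (W.card - s) (wt m W α) then ⊤ else ⊥
  have key := dF_graded (m := m) (N := NN m) x Q ?_ ?_ s z ?_ W α
  · simpa [Q, h] using key
  · intro s W v α hv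
    simp only [Q, wt_inl, card_insert_of_notMem hv]
    congr 2
    push_cast
    ring
  · intro s W k α u i hk a ha
    have h3 : (((insert (Sum.inr k) W).card : ℤ) - s) = W.card - (s - 1) := by
      rw [card_insert_of_notMem hk]
      push_cast
      ring
    simp only [Q, wt_inr m W k α u hk, h3] at ha ⊢
    split_ifs at ha ⊢
    · trivial
    · rw [AddSubgroup.mem_bot] at ha ⊢
      rw [ha, mul_zero]
  · intro W α
    simp only [Q]
    split_ifs with h4
    · trivial
    · exact hz W α h4

theorem mem_cset_iff {i : ℕ} {W : Finset (II m (NN m))} {α : GG m} : (W, α) ∈ cset m i ↔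
    crt W α ∧ (W.card : ℤ) - i = ((∑ j, m j : ℕ) : ℤ) ∧ wt m W α = fun j => (dS m j.1 : ℤ) := by
  simp only [cset, Set.mem_ofPred_eq, funext_iff]
  refine and_congr_right fun _ => and_congr_left fun _ => ?_
  omega

theorem dF_ex_not {i : ℕ} (f) {W α} (h : ¬ (crt W α ∧ (W.card : ℤ) - (i - 1) = ((∑ j, m j : ℕ) : ℤ) ∧
    wt m W α = fun j => (dS m j.1 : ℤ))) : dF m (NN m) x (ex m S i f) W α = 0 := by
  by_cases hc : crt W α
  · refine dF_supp m x (fun a w => a = ((∑ j, m j : ℕ) : ℤ) ∧ w = fun j => (dS m j.1 : ℤ)) i _ ?_ W α ?_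
    · intro W α h2
      refine ex_not m f fun h3 => h2 ?_
      rw [mem_cset_iff] at h3
      exact h3.2
    · exact fun h2 => h ⟨hc, h2⟩
  · rw [← pr_dF, pr_zero _ hc]

theorem ex_re_dF {i : ℕ} (f) : ex m S i (re m S i (dF m (NN m) x (ex m S (i + 1) f))) =
    dF m (NN m) x (ex m S (i + 1) f) := by
  refine ex_re m _ fun W α h => dF_ex_not m x f fun h2 => h ?_
  rw [mem_cset_iff]
  push_cast at h2
  simpa using h2

theorem dF_ex_zero (f) : dF m (NN m) x (ex m S 0 f) = 0 := by
  funext W α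
  refine dF_ex_not m x f ?_
  rintro ⟨h1, h2, h3⟩
  obtain ⟨a, _, h4, _⟩ := crit_struct m h1 (fun j => congrFun h3 j)
  push_cast [h4] at h2
  omega

theorem re_dF {i : ℕ} (z) (hz : pr m (NN m) S z = z) : re m S i (dF m (NN m) x z) =
    re m S i (dF m (NN m) x (ex m S (i + 1) (re m S (i + 1) z))) := by
  rw [← sub_eq_zero, ← map_sub, ← map_sub]
  funext p
  rw [re_apply]
  have hp := (cell m i p).2
  generalize (cell m i p).1 = c at hp
  obtain ⟨W, α⟩ := c
  rw [mem_cset_iff] at hp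
  refine dF_supp m x (fun a w => ¬ (a = ((∑ j, m j : ℕ) : ℤ) ∧ w = fun j => (dS m j.1 : ℤ)))
    (i + 1 : ℕ) _ ?_ W α ?_
  · intro W α h
    rw [not_not] at h
    by_cases hc : crt W α
    · have : (W, α) ∈ cset m (i + 1) := by
        rw [mem_cset_iff]
        exact ⟨hc, h⟩
      simp only [Pi.sub_apply]
      rw [ex_re_mem m _ this, sub_self]
    · simp only [Pi.sub_apply]
      rw [ex_not, ← hz, pr_zero _ hc, sub_zero]
      exact fun h => hc h.1
  · rw [not_not]
    push_cast
    simpa using hp.2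

def dl (i : ℕ) : (Fin (rk m (i + 1)) → S) →ₗ[S] (Fin (rk m i) → S) :=
  re m S i ∘ₗ dF m (NN m) x ∘ₗ ex m S (i + 1)

theorem ex_dl (i : ℕ) (f) : ex m S i (dl m x i f) = dF m (NN m) x (ex m S (i + 1) f) :=
  ex_re_dF m x f

theorem dl_dl (i : ℕ) (f) : dl m x i (dl m x (i + 1) f) = 0 := by
  have h : dF m (NN m) x (dF m (NN m) x (ex m S (i + 1 + 1) f)) = 0 :=
    LinearMap.congr_fun (dF_sq (m := m) (N := NN m) x) _
  show re m S i (dF m (NN m) x (ex m S (i + 1) (dl m x (i + 1) f))) = 0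
  rw [ex_dl, h, map_zero]

theorem dl_tors_aux [IsNoetherianRing S] (i : Fin n) : ∃ M, ∀ (a : ℕ) (f : Fin (rk m a) → S),
    dF m (NN m) x (ex m S a f) = 0 → ∃ g, x i ^ M • f = dl m x a g := by
  obtain ⟨M, hM⟩ := dF_torsion (m := m) (N := NN m) x le_rfl i
  refine ⟨M, fun a f hf => ?_⟩
  obtain ⟨w, hw⟩ := hM _ (pr_ex m a f) hf
  refine ⟨re m S (a + 1) (pr m (NN m) S w), ?_⟩
  rw [← dF_pr] at hw
  have := congrArg (re m S a) hw
  rw [map_smul, re_ex, re_dF m x _ (pr_pr w)] at this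
  exact this

theorem dl_tors0 [IsNoetherianRing S] (i : Fin n) : ∃ M, ∀ f : Fin (rk m 0) → S,
    ∃ g, x i ^ M • f = dl m x 0 g := by
  obtain ⟨M, hM⟩ := dl_tors_aux m x i
  exact ⟨M, fun f => hM 0 f (dF_ex_zero m x f)⟩

theorem dl_tors [IsNoetherianRing S] (i : Fin n) (a : ℕ) (f) (hf : dl m x a f = 0) :
    ∃ M g, x i ^ M • f = dl m x (a + 1) g := by
  obtain ⟨M, hM⟩ := dl_tors_aux m x i
  refine ⟨M, hM (a + 1) f ?_⟩
  rw [← ex_dl, hf, map_zero]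

theorem rk_zero {i : ℕ} (h : n < i) : rk m i = 0 := by
  have : IsEmpty (cset m i) := ⟨fun c => by
    have := (cset_struct m c.2).1
    omega⟩
  exact Nat.card_of_isEmpty

theorem rk_ne_zero {i : ℕ} (h : i ≤ n) : rk m i ≠ 0 := by
  have : Finite (cset m i) := cset_finite m i
  have : Nonempty (cset m i) := (cset_nonempty m i h).to_subtype
  exact Nat.card_pos.ne'

end Strand

section WR
variable (K : Type) [Field K] (n : ℕ)

theorem wr_S : RingTheory.Sequence.IsWeaklyRegular (MvPolynomial (Fin n) K)
    (List.ofFn (fun i : Fin n => (X i : MvPolynomial (Fin n) K))) := by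
  rw [RingTheory.Sequence.isWeaklyRegular_iff]
  intro i hi
  have hi' : i < n := by simpa using hi
  have hspan : (Ideal.ofList ((List.ofFn (fun i : Fin n => (X i : MvPolynomial (Fin n) K))).take i) :
      Ideal (MvPolynomial (Fin n) K)) = Ideal.span (X '' {j : Fin n | j.1 < i}) := by
    rw [Ideal.ofList]
    congr 1
    ext y
    simp only [Set.mem_ofPred_eq, Set.mem_image, List.mem_take_iff_getElem, List.getElem_ofFn,
      List.length_ofFn]
    constructor
    · rintro ⟨k, hk, rfl⟩
      exact ⟨⟨k, by omega⟩, by simp; omega, rfl⟩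
    · rintro ⟨j, hj, rfl⟩
      exact ⟨j.1, by have := j.2; omega, rfl⟩
  rw [hspan, Ideal.smul_top_eq_map, isSMulRegular_quotient_iff_mem_of_smul_mem]
  intro p hp
  have hsimp : ∀ q : MvPolynomial (Fin n) K, q ∈ (Submodule.restrictScalars (MvPolynomial (Fin n) K)
      (Ideal.map (algebraMap (MvPolynomial (Fin n) K) (MvPolynomial (Fin n) K))
        (Ideal.span (X '' {j : Fin n | j.1 < i})))) ↔
      q ∈ Ideal.span (X '' {j : Fin n | j.1 < i} : Set (MvPolynomial (Fin n) K)) := by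
    intro q
    rw [Submodule.restrictScalars_mem, Algebra.algebraMap_self, Ideal.map_id]
  rw [hsimp, mem_ideal_span_X_image] at hp ⊢
  intro v hv
  obtain ⟨j, hj, hne⟩ := hp (v + Finsupp.single ⟨i, hi'⟩ 1) (by
    rw [MvPolynomial.mem_support_iff] at hv ⊢
    simp only [List.getElem_ofFn, smul_eq_mul]
    rw [mul_comm, coeff_mul_X]
    exact hv)
  refine ⟨j, hj, ?_⟩
  have hji : j ≠ ⟨i, hi'⟩ := by
    rintro rfl
    simp at hj
  simpa [Finsupp.single_apply, hji.symm] using hne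

theorem wr_pi (r : ℕ) : RingTheory.Sequence.IsWeaklyRegular (Fin r → MvPolynomial (Fin n) K)
    (List.ofFn (fun i : Fin n => (X i : MvPolynomial (Fin n) K))) := by
  have := (wr_S K n).isWeaklyRegular_lTensor (M₂ := Fin r → MvPolynomial (Fin n) K)
  exact ((TensorProduct.rid _ _).isWeaklyRegular_congr _).1 this

end WR

section Fin
variable {K : Type} [Field K] {n : ℕ} (m : Fin n → ℕ)

theorem mem_homogZ {z : ℤ} {p : PolyS K n} :
    p ∈ homogZ K n z ↔ p = 0 ∨ (0 ≤ z ∧ p.IsHomogeneous z.toNat) := by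
  by_cases h : 0 ≤ z
  · simp only [homogZ, h, iSup_pos, true_and]
    rw [mem_homogeneousSubmodule]
    constructor
    · exact Or.inr
    · rintro (rfl | h)
      · exact isHomogeneous_zero _ _ _
      · exact h
  · simp [homogZ, h]

theorem X_mul_homogZ {z : ℤ} {p : PolyS K n} (i : Fin n) (h : p ∈ homogZ K n z) :
    X i * p ∈ homogZ K n (z + 1) := by
  rw [mem_homogZ] at h ⊢
  rcases h with rfl | ⟨h1, h2⟩
  · simp
  · right
    refine ⟨by omega, ?_⟩
    have := (isHomogeneous_X K i).mul h2
    convert this using 1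
    omega

variable (K) in
abbrev dX (i : ℕ) := dl m (X : Fin n → PolyS K n) i

theorem dX_homog (i : ℕ) (p q) :
    dX K m i (Pi.single q 1) p ∈ homogZ K n ((dS m (i + 1) : ℤ) - dS m i) := by
  classical
  let Q : ℤ → Finset (II m (NN m)) → GG m → AddSubgroup (PolyS K n) := fun _ W _ =>
    (homogZ K n ((dS m (i + 1) : ℤ) - jJ W)).toAddSubgroup
  have key := dF_graded (m := m) (N := NN m) X Q ?_ ?_ 0
    (ex m (PolyS K n) (i + 1) (Pi.single q 1)) ?_ (cell m i p).1.1 (cell m i p).1.2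
  · have hp := (cset_struct m (cell m i p).2).2.1
    simp only [Q, hp] at key
    exact key
  · intro s W v α hv
    simp only [Q, jJ_inl]
  · intro s W k α u j hk a ha
    simp only [Q, jJ_inr W k hk, Submodule.mem_toAddSubgroup] at ha ⊢
    have := X_mul_homogZ j ha
    convert this using 2
    push_cast
    ring
  · intro W α
    simp only [Q, Submodule.mem_toAddSubgroup]
    by_cases hc : (W, α) ∈ cset m (i + 1)
    · have h1 : jJ W = dS m (i + 1) := (cset_struct m hc).2.1
      rw [ex_mem m _ hc, h1, sub_self, mem_homogZ]
      rw [Pi.single_apply]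
      split_ifs
      · exact Or.inr ⟨le_rfl, isHomogeneous_one _ _⟩
      · exact Or.inl rfl
    · rw [ex_not m _ hc]
      exact zero_mem _

theorem dX_exact (i : ℕ) (z) (hz : dX K m i z = 0) : ∃ w, z = dX K m (i + 1) w := by
  refine acyc (List.ofFn (fun i : Fin n => (X i : PolyS K n))) (fun i => Fin (rk m i) → PolyS K n)
    (fun i => dX K m i) (fun i z => dl_dl m X i z) n ?_ (fun i => wr_pi K n _) ?_ ?_ i ?_ z hz
  · intro i hi
    have := rk_zero m hi
    show Subsingleton (Fin (rk m i) → PolyS K n)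
    rw [this]
    infer_instance
  · intro y hy z
    rw [List.mem_ofFn] at hy
    obtain ⟨j, rfl⟩ := hy
    obtain ⟨M, hM⟩ := dl_tors0 m (X : Fin n → PolyS K n) j
    exact ⟨M, hM z⟩
  · intro y hy i z hz
    rw [List.mem_ofFn] at hy
    obtain ⟨j, rfl⟩ := hy
    exact dl_tors m X j i z hz
  · simp

theorem fin_len : ∃ B : ℕ, ∀ z : ℤ, (B : ℤ) ≤ z → ∀ f : Fin (rk m 0) → PolyS K n,
    (∀ p, f p ∈ homogZ K n z) → ∃ g, f = dX K m 0 g := by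
  classical
  choose M hM using fun j => dl_tors0 m (X : Fin n → PolyS K n) j
  refine ⟨∑ j, M j + 1, fun z hz f hf => ?_⟩
  suffices h : ∀ p, ∀ a : PolyS K n, a ∈ homogZ K n z →
      (Pi.single p a : Fin (rk m 0) → PolyS K n) ∈ LinearMap.range (dX K m 0) by
    have h2 : f ∈ LinearMap.range (dX K m 0) := by
      rw [← Finset.univ_sum_single f]
      exact Submodule.sum_mem _ fun p _ => h p _ (hf p)
    obtain ⟨g, hg⟩ := h2
    exact ⟨g, hg.symm⟩
  intro p a ha
  rw [mem_homogZ] at ha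
  rcases ha with rfl | ⟨_, ha⟩
  · simp
  rw [a.as_sum]
  have : (Pi.single p (∑ v ∈ a.support, monomial v (a.coeff v)) : Fin (rk m 0) → PolyS K n) =
      ∑ v ∈ a.support, Pi.single p (monomial v (a.coeff v)) :=
    map_sum (LinearMap.single (PolyS K n) (fun _ : Fin (rk m 0) => PolyS K n) p) _ _
  rw [this]
  refine Submodule.sum_mem _ fun v hv => ?_
  have hdeg : ∑ j, v j = z.toNat := by
    have := ha (MvPolynomial.mem_support_iff.1 hv)
    rw [← this, Finsupp.weight_apply, Finsupp.sum_fintype] <;> simp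
  obtain ⟨j, hj⟩ : ∃ j, M j ≤ v j := by
    by_contra hcon
    push Not at hcon
    have := Finset.sum_le_sum fun j (_ : j ∈ univ) => (hcon j).le
    omega
  have hmon : monomial v (a.coeff v) = (X j : PolyS K n) ^ M j *
      monomial (v - Finsupp.single j (M j)) (a.coeff v) := by
    rw [X_pow_eq_monomial, monomial_mul, one_mul, add_tsub_cancel_of_le]
    simpa using hj
  obtain ⟨g, hg⟩ := hM j (Pi.single p (monomial (v - Finsupp.single j (M j)) (a.coeff v)))
  refine ⟨g, ?_⟩
  rw [← hg, hmon, ← smul_eq_mul, Pi.single_smul]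

end Fin

end PR

namespace PR
set_option linter.unusedSectionVars false
set_option linter.style.haveILetI false

section Final
variable (K : Type) [Field K] {n : ℕ} (m : Fin n → ℕ) (d0 : ℤ)

theorem mulVec_dX (i : ℕ) : (LinearMap.toMatrix' (dX K m i)).mulVecLin = dX K m i :=
  Matrix.toLin'_toMatrix' _

def FC : FreeComplex K n where
  len := n
  rk := rk m
  deg i _ := d0 + dS m i
  dd i := LinearMap.toMatrix' (dX K m i)
  rk_eq_zero i hi := rk_zero m hi
  isHomog i p q := by
    have := dX_homog (K := K) m i p q
    rw [LinearMap.toMatrix'_apply]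
    have h2 : d0 + (dS m (i + 1) : ℤ) - (d0 + dS m i) = dS m (i + 1) - dS m i := by ring
    rw [h2]
    exact this
  isComplex i := by
    rw [← LinearMap.toMatrix'_comp]
    have : dX K m i ∘ₗ dX K m (i + 1) = 0 := LinearMap.ext fun z => dl_dl m X i z
    rw [this, map_zero]

theorem FC_res : IsResolution (FC K m d0) := by
  intro i
  show LinearMap.ker (LinearMap.toMatrix' (dX K m i)).mulVecLin =
    LinearMap.range (LinearMap.toMatrix' (dX K m (i + 1))).mulVecLin
  rw [mulVec_dX, mulVec_dX]
  ext z
  rw [LinearMap.mem_ker, LinearMap.mem_range]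
  constructor
  · intro h
    obtain ⟨w, hw⟩ := dX_exact m i z h
    exact ⟨w, hw.symm⟩
  · rintro ⟨w, rfl⟩
    exact dl_dl m X i w

theorem FC_min : IsMinimal (FC K m d0) := by
  intro i p q h
  exfalso
  have hi : i + 1 ≤ n := by
    by_contra hcon
    have h1 := rk_zero m (show n < i + 1 by omega)
    have h2 : q.1 < rk m (i + 1) := q.2
    omega
  have h1 : d0 + (dS m (i + 1) : ℤ) = d0 + dS m i := h
  have h2 := dS_eq m hi (show i ≤ n by omega) (by omega)
  omega

theorem FC_fin : {ℓ : ℤ | MPieceDim (FC K m d0) ℓ ≠ 0}.Finite := by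
  obtain ⟨B, hB⟩ := fin_len (K := K) m
  refine (Set.finite_Icc d0 (d0 + B)).subset fun ℓ hℓ => ?_
  by_contra hcon
  apply hℓ
  have hz : ((dS m 0 : ℕ) : ℤ) = 0 := by rw [dS_zero]; rfl
  suffices h : Submodule.comap (freePiece ((FC K m d0).deg 0) ℓ).subtype
      ((LinearMap.range (((FC K m d0).dd 0).mulVecLin)).restrictScalars K) = ⊤ by
    rw [MPieceDim, h]
    exact finrank_zero_of_subsingleton
  rw [eq_top_iff]
  rintro ⟨f, hf⟩ -
  have hf' : ∀ p, f p ∈ homogZ K n (ℓ - d0) := by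
    intro p
    have h1 : f p ∈ homogZ K n (ℓ - (d0 + dS m 0)) := (Submodule.mem_pi.1 hf) p (Set.mem_univ p)
    rwa [hz, add_zero] at h1
  show f ∈ LinearMap.range (LinearMap.toMatrix' (dX K m 0)).mulVecLin
  rw [mulVec_dX]
  by_cases h : ℓ < d0
  · have : f = 0 := by
      funext p
      rcases mem_homogZ.1 (hf' p) with h1 | h1
      · exact h1
      · omega
    rw [this]
    exact zero_mem _
  · have h2 : (B : ℤ) ≤ ℓ - d0 := by
      by_contra h3
      exact hcon ⟨by omega, by omega⟩
    obtain ⟨g, hg⟩ := hB _ h2 f hf'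
    exact ⟨g, hg.symm⟩

end Final

theorem final (K : Type) [Field K] (n : ℕ)
    (d : Fin (n + 1) → ℤ) (hd : StrictMono d) :
    ∃ F : FreeComplex K n,
      IsResolution F ∧ IsMinimal F ∧
      {ℓ : ℤ | MPieceDim F ℓ ≠ 0}.Finite ∧
      (∀ i, n < i → F.rk i = 0) ∧
      (∀ i : ℕ, ∀ h : i ≤ n,
        F.rk i ≠ 0 ∧ ∀ p : Fin (F.rk i), F.deg i p = d ⟨i, Nat.lt_succ_of_le h⟩) ∧
      F.rk 0 = ∏ i : Fin n,
        Nat.choose (d i.succ - d 0 - 1).toNat (d i.succ - d i.castSucc - 1).toNat := by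
  let m : Fin n → ℕ := fun j => (d j.succ - d j.castSucc - 1).toNat
  have hm : ∀ j : Fin n, (m j : ℤ) = d j.succ - d j.castSucc - 1 := by
    intro j
    have := hd (Fin.castSucc_lt_succ (i := j))
    exact Int.toNat_of_nonneg (by omega)
  have hdS : ∀ i : ℕ, ∀ h : i ≤ n, d 0 + (dS m i : ℤ) = d ⟨i, Nat.lt_succ_of_le h⟩ := by
    intro i
    induction i with
    | zero => intro _; rw [dS_zero]; simp
    | succ i ih =>
      intro h
      have h1 := ih (by omega)
      have h2 := dS_succ m ⟨i, by omega⟩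
      have h3 := hm ⟨i, by omega⟩
      simp only [Fin.succ_mk, Fin.castSucc_mk] at h2 h3
      rw [h2]
      push_cast
      omega
  refine ⟨FC K m (d 0), FC_res K m _, FC_min K m _, FC_fin K m _, fun i hi => rk_zero m hi,
    fun i hi => ⟨rk_ne_zero m hi, fun p => hdS i hi⟩, ?_⟩
  show Nat.card (cset m 0) = _
  rw [cset_card_zero]
  refine Finset.prod_congr rfl fun j _ => ?_
  congr 1
  have h1 := hdS (j.1 + 1) (by omega)
  have h2 := dS_succ m j
  have h3 : (⟨j.1 + 1, by omega⟩ : Fin (n + 1)) = j.succ := rfl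
  rw [h3] at h1
  omega

end PR

/-- Let `K` be any field and `d = (d_0 < d_1 < … < d_n)` a
strictly increasing sequence of `n+1` integers. There exists a graded
`K[x_1, …, x_n]`-module of finite length (namely `M = coker (F₁ → F₀)`) with
`β_0 = ∏_{i=1}^n binom(d_i - d_0 - 1, d_i - d_{i-1} - 1)` generators whose
minimal graded free resolution is pure with degree sequence `d`. -/
theorem pure_resolution_exists (K : Type) [Field K] (n : ℕ)
    (d : Fin (n + 1) → ℤ) (hd : StrictMono d) :
    ∃ F : FreeComplex K n,
      IsResolution F ∧ IsMinimal F ∧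
      {ℓ : ℤ | MPieceDim F ℓ ≠ 0}.Finite ∧
      (∀ i, n < i → F.rk i = 0) ∧
      (∀ i : ℕ, ∀ h : i ≤ n,
        F.rk i ≠ 0 ∧ ∀ p : Fin (F.rk i), F.deg i p = d ⟨i, by omega⟩) ∧
      F.rk 0 = ∏ i : Fin n,
        Nat.choose (d i.succ - d 0 - 1).toNat (d i.succ - d i.castSucc - 1).toNat := by
  exact PR.final K n d hd

end
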